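/- Let d ≥ 1 and fix β ∈ [1,2). Let (p_t)_{t≥0} be the marginal laws of an isotropic Lévy process on ℝ^d, so its characteristic exponent ψ is radial (write ψ(s) for its common value on ‖x‖ = s), and assume ψ ∈ R_α with α ∈ (β, 2]. Let ψ^− denote the generalized inverse of ψ*(u) = sup_{s≤u} ψ(s). Let g be a bounded Borel function and μ a finite Borel measure on ℝ^d, set r = g ∗ μ̌, and assume: for every θ ∈ S^{d−1} the limit R_β(θ) := lim_{t→0+} t^{−β}(r(tθ) + r(−tθ) − 2r(0)) exists, and |r(x) + r(−x) − 2r(0)| ≤ L‖x‖^β for all x ∈ ℝ^d and some L > 0. Then lim_{t→0+} [ψ^−(1/t)]^β (H_g^μ(t) − H_g^μ(0)) = π^{−d/2} 4^{β/2 − 1} Γ((d+β)/2) · (Γ(1 − β/α) / Γ(1 − β/2)) · ∫_{S^{d−1}} R_β(θ) σ(dθ), where σ is the surface measure on the unit sphere S^{d−1}. -/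

import Mathlib

open MeasureTheory Filter Metric
open scoped Topology RealInnerProductSpace ENNReal

section Exponent

theorem one_sub_cos_sub_le (a b : ℝ) :
    1 - Real.cos (a - b) ≤ 2 * (1 - Real.cos a) + 2 * (1 - Real.cos b) := by
  have h : ∀ x : ℝ, 1 - Real.cos x = 2 * Real.sin (x / 2) ^ 2 := fun x => by
    rw [Real.sin_sq_eq_half_sub]; ring_nf
  rw [h, h, h, sub_div, Real.sin_sub]
  have h1 := Real.sin_sq_add_cos_sq (a / 2)
  have h2 := Real.sin_sq_add_cos_sq (b / 2)
  set s := Real.sin (a / 2)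
  set c := Real.cos (a / 2)
  set s' := Real.sin (b / 2)
  set c' := Real.cos (b / 2)
  have h3 : (s * c') ^ 2 ≤ s ^ 2 := by nlinarith [sq_nonneg (s * s')]
  have h4 : (c * s') ^ 2 ≤ s' ^ 2 := by nlinarith [sq_nonneg (s * s')]
  nlinarith [sq_nonneg (s * c' + c * s')]

theorem one_sub_cos_nat_mul_le (n : ℕ) (a : ℝ) :
    1 - Real.cos (n * a) ≤ n ^ 2 * (1 - Real.cos a) := by
  have h : ∀ x : ℝ, 1 - Real.cos x = 2 * Real.sin (x / 2) ^ 2 := fun x => by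
    rw [Real.sin_sq_eq_half_sub]; ring_nf
  have key : ∀ x : ℝ, |Real.sin (n * x)| ≤ n * |Real.sin x| := by
    intro x
    induction n with
    | zero => simp
    | succ k ih =>
      push_cast
      rw [add_mul, one_mul, Real.sin_add]
      refine (abs_add_le _ _).trans ?_
      rw [abs_mul, abs_mul, add_mul, one_mul]
      exact add_le_add
        ((mul_le_of_le_one_right (abs_nonneg _) (Real.abs_cos_le_one _)).trans ih)
        (mul_le_of_le_one_left (abs_nonneg _) (Real.abs_cos_le_one _))
  rw [h, h, mul_div_assoc]
  have := key (a / 2)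
  have h2 : |Real.sin (n * (a / 2))| ^ 2 ≤ (n * |Real.sin (a / 2)|) ^ 2 := by gcongr
  rw [mul_pow, sq_abs, sq_abs] at h2
  linarith

variable {E : Type*} [NormedAddCommGroup E] [InnerProductSpace ℝ E]

theorem one_sub_cos_inner_le (ξ y : E) :
    1 - Real.cos ⟪ξ, y⟫ ≤ (2 + ‖ξ‖ ^ 2) * min 1 (‖y‖ ^ 2) := by
  have h1 : 1 - Real.cos ⟪ξ, y⟫ ≤ 2 := by linarith [Real.neg_one_le_cos ⟪ξ, y⟫]
  have h2 : 1 - Real.cos ⟪ξ, y⟫ ≤ ⟪ξ, y⟫ ^ 2 / 2 := by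
    linarith [Real.one_sub_sq_div_two_le_cos (x := ⟪ξ, y⟫)]
  have h3 : ⟪ξ, y⟫ ^ 2 ≤ (‖ξ‖ * ‖y‖) ^ 2 := sq_le_sq' (by
    linarith [neg_abs_le ⟪ξ, y⟫, abs_real_inner_le_norm ξ y]) (real_inner_le_norm ξ y)
  rcases le_total 1 (‖y‖ ^ 2) with h | h
  · rw [min_eq_left h]; nlinarith [sq_nonneg ‖ξ‖]
  · rw [min_eq_right h]; nlinarith [sq_nonneg ‖ξ‖, sq_nonneg ‖y‖, sq_nonneg (‖ξ‖ * ‖y‖)]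

variable [MeasurableSpace E] [BorelSpace E] [SecondCountableTopology E]

/-- The characteristic exponent with Gaussian part `lam` and Lévy measure `ν`. -/
noncomputable def levyExponent (lam : ℝ) (ν : Measure E) (ξ : E) : ℝ :=
  lam * ‖ξ‖ ^ 2 + ∫ y, (1 - Real.cos ⟪ξ, y⟫) ∂ν

variable {lam : ℝ} {ν : Measure E}

theorem integrable_one_sub_cos_inner
    (hν : ∫⁻ y, ENNReal.ofReal (min 1 (‖y‖ ^ 2)) ∂ν < ⊤) (ξ : E) :
    Integrable (fun y => 1 - Real.cos ⟪ξ, y⟫) ν := by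
  have h : Integrable (fun y : E => min 1 (‖y‖ ^ 2)) ν :=
    ⟨by fun_prop, (hasFiniteIntegral_iff_ofReal (.of_forall fun y => by positivity)).2 hν⟩
  refine (h.const_mul (2 + ‖ξ‖ ^ 2)).mono' (by fun_prop) (.of_forall fun y => ?_)
  rw [Real.norm_of_nonneg (by linarith [Real.cos_le_one ⟪ξ, y⟫])]
  exact one_sub_cos_inner_le ξ y

omit [BorelSpace E] [SecondCountableTopology E] in
theorem levyExponent_nonneg (hlam : 0 ≤ lam) (ξ : E) : 0 ≤ levyExponent lam ν ξ :=
  add_nonneg (by positivity) (integral_nonneg fun y => by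
    simp [Real.cos_le_one])

theorem levyExponent_sub_le (hlam : 0 ≤ lam)
    (hν : ∫⁻ y, ENNReal.ofReal (min 1 (‖y‖ ^ 2)) ∂ν < ⊤) (ξ η : E) :
    levyExponent lam ν (ξ - η) ≤ 2 * levyExponent lam ν ξ + 2 * levyExponent lam ν η := by
  have hi := integrable_one_sub_cos_inner hν
  have h1 : ∫ y, (1 - Real.cos ⟪ξ - η, y⟫) ∂ν ≤
      2 * ∫ y, (1 - Real.cos ⟪ξ, y⟫) ∂ν + 2 * ∫ y, (1 - Real.cos ⟪η, y⟫) ∂ν := by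
    rw [← integral_const_mul, ← integral_const_mul,
      ← integral_add ((hi ξ).const_mul 2) ((hi η).const_mul 2)]
    refine integral_mono (hi _) (((hi ξ).const_mul 2).add ((hi η).const_mul 2)) fun y => ?_
    simp only [inner_sub_left]
    exact one_sub_cos_sub_le _ _
  have h2 : ‖ξ - η‖ ^ 2 ≤ 2 * ‖ξ‖ ^ 2 + 2 * ‖η‖ ^ 2 := by
    have := parallelogram_law_with_norm ℝ ξ η
    nlinarith [mul_self_nonneg ‖ξ + η‖]
  unfold levyExponent
  nlinarith

theorem levyExponent_nat_smul_le
    (hν : ∫⁻ y, ENNReal.ofReal (min 1 (‖y‖ ^ 2)) ∂ν < ⊤) (n : ℕ) (ξ : E) :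
    levyExponent lam ν ((n : ℝ) • ξ) ≤ n ^ 2 * levyExponent lam ν ξ := by
  have hi := integrable_one_sub_cos_inner hν
  have h1 : ∫ y, (1 - Real.cos ⟪(n : ℝ) • ξ, y⟫) ∂ν ≤
      n ^ 2 * ∫ y, (1 - Real.cos ⟪ξ, y⟫) ∂ν := by
    rw [← integral_const_mul]
    refine integral_mono (hi _) ((hi ξ).const_mul _) fun y => ?_
    simp only [real_inner_smul_left]
    exact one_sub_cos_nat_mul_le n _
  unfold levyExponent
  rw [norm_smul, mul_pow, Real.norm_natCast]
  linarith

theorem exists_levyExponent_le (hlam : 0 ≤ lam)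
    (hν : ∫⁻ y, ENNReal.ofReal (min 1 (‖y‖ ^ 2)) ∂ν < ⊤) :
    ∃ C : ℝ, 0 ≤ C ∧ ∀ ξ : E, levyExponent lam ν ξ ≤ C * (2 + ‖ξ‖ ^ 2) := by
  have h : Integrable (fun y : E => min 1 (‖y‖ ^ 2)) ν :=
    ⟨by fun_prop, (hasFiniteIntegral_iff_ofReal (.of_forall fun y => by positivity)).2 hν⟩
  have h0 : 0 ≤ ∫ y : E, min 1 (‖y‖ ^ 2) ∂ν := integral_nonneg fun y => by positivity
  refine ⟨lam + ∫ y, min 1 (‖y‖ ^ 2) ∂ν, by positivity, fun ξ => ?_⟩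
  have h1 : ∫ y, (1 - Real.cos ⟪ξ, y⟫) ∂ν ≤ (2 + ‖ξ‖ ^ 2) * ∫ y, min 1 (‖y‖ ^ 2) ∂ν := by
    rw [← integral_const_mul]
    exact integral_mono (integrable_one_sub_cos_inner hν ξ) (h.const_mul _)
      fun y => one_sub_cos_inner_le ξ y
  unfold levyExponent
  nlinarith [sq_nonneg ‖ξ‖]

end Exponent

section RegularVariation

/-- The properties of the radial profile of an isotropic characteristic exponent that are
used in the analysis of its regular variation. -/
structure RadialExponent (q : ℝ → ℝ) : Prop where
  continuous : Continuous q
  even : ∀ x, q (-x) = q x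
  nonneg : ∀ x, 0 ≤ q x
  zero : q 0 = 0
  sub_le : ∀ x y, q (x - y) ≤ 2 * q x + 2 * q y
  nat_mul_le : ∀ (n : ℕ) x, q (n * x) ≤ n ^ 2 * q x

variable {q : ℝ → ℝ} {α : ℝ}

theorem RadialExponent.exists_near_zero_bound (hq : RadialExponent q)
    (hpos : ∀ s, 0 < s → 0 < q s)
    (hreg : ∀ l, 0 < l → Tendsto (fun s => q (l * s) / q s) atTop (𝓝 (l ^ α))) :
    ∃ K δ B : ℝ, 0 < K ∧ 0 < δ ∧ 0 < B ∧ ∀ s, B ≤ s → ∀ l, 0 ≤ l → l ≤ δ →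
      q (l * s) ≤ K * q s := by
  let F : ℕ → Set ℝ := fun n => {x | ∀ s : ℝ, (n : ℝ) ≤ s → q (x * s) ≤ n * q s}
  have hF : ∀ n, IsClosed (F n) := fun n => by
    have : F n = ⋂ (s : ℝ) (_ : (n : ℝ) ≤ s), {x | q (x * s) ≤ n * q s} := by
      ext x; simp [F]
    rw [this]
    exact isClosed_iInter fun s => isClosed_iInter fun _ =>
      isClosed_le (hq.continuous.comp (by fun_prop)) continuous_const
  have hpt : ∀ x : ℝ, 0 < x → ∃ n, x ∈ F n ∧ -x ∈ F n := by
    intro x hx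
    have h1 : ∀ᶠ s in atTop, q (x * s) / q s < x ^ α + 1 :=
      (hreg x hx).eventually_lt_const (by linarith)
    obtain ⟨s0, hs0⟩ := eventually_atTop.1 h1
    obtain ⟨n, hn⟩ := exists_nat_ge (max (max s0 (x ^ α + 1)) 1)
    have hn1 : s0 ≤ n := (le_max_left _ _).trans ((le_max_left _ _).trans hn)
    have hn2 : x ^ α + 1 ≤ n := (le_max_right _ _).trans ((le_max_left _ _).trans hn)
    have hn3 : (1 : ℝ) ≤ n := (le_max_right _ _).trans hn
    have key : ∀ s : ℝ, (n : ℝ) ≤ s → q (x * s) ≤ n * q s := by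
      intro s hs
      have hqs := hpos s (by linarith)
      have := (div_lt_iff₀ hqs).1 (hs0 s (hn1.trans hs))
      nlinarith
    exact ⟨n, key, fun s hs => by rw [neg_mul, hq.even]; exact key s hs⟩
  have hU : ⋃ n, F n = Set.univ := by
    refine Set.eq_univ_of_forall fun x => Set.mem_iUnion.2 ?_
    rcases lt_trichotomy x 0 with h | h | h
    · obtain ⟨n, -, hn⟩ := hpt (-x) (by linarith)
      exact ⟨n, by simpa using hn⟩
    · refine ⟨0, fun s hs => ?_⟩
      simp [h, hq.zero]
    · obtain ⟨n, hn, -⟩ := hpt x h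
      exact ⟨n, hn⟩
  obtain ⟨n, x, hx⟩ := nonempty_interior_of_iUnion_of_closed hF hU
  obtain ⟨ε, hε, hball⟩ := Metric.isOpen_iff.1 isOpen_interior x hx
  have hsub : ball x ε ⊆ F n := hball.trans interior_subset
  refine ⟨4 * n + 1, ε / 2, n + 1, by positivity, by positivity, by positivity, ?_⟩
  intro s hs l hl0 hl
  have h1 := hsub (mem_ball_self hε) s (by linarith)
  have h2 := hsub (show x + l ∈ ball x ε by
    rw [mem_ball, Real.dist_eq]; simp [abs_of_nonneg hl0]; linarith) s (by linarith)
  have h3 := hq.sub_le ((x + l) * s) (x * s)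
  rw [← sub_mul, add_sub_cancel_left] at h3
  have := hq.nonneg s
  linarith

theorem RadialExponent.exists_le_mul (hq : RadialExponent q)
    (hpos : ∀ s, 0 < s → 0 < q s)
    (hreg : ∀ l, 0 < l → Tendsto (fun s => q (l * s) / q s) atTop (𝓝 (l ^ α))) :
    ∃ K B : ℝ, 0 < K ∧ 0 < B ∧ ∀ s, B ≤ s → ∀ l, 0 ≤ l → l ≤ 1 → q (l * s) ≤ K * q s := by
  obtain ⟨K, δ, B, hK, hδ, hB, h⟩ := hq.exists_near_zero_bound hpos hreg
  obtain ⟨s0, hs0⟩ := eventually_atTop.1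
    ((hreg δ⁻¹ (inv_pos.2 hδ)).eventually_lt_const (lt_add_one _))
  have hM : 0 < δ⁻¹ ^ α + 1 := by positivity
  refine ⟨K * (δ⁻¹ ^ α + 1), max (max s0 (δ * B)) 1, by positivity, by positivity, ?_⟩
  intro s hs l hl0 hl1
  have hs1 : s0 ≤ s := (le_max_left _ _).trans ((le_max_left _ _).trans hs)
  have hs2 : δ * B ≤ s := (le_max_right _ _).trans ((le_max_left _ _).trans hs)
  have hs3 : 1 ≤ s := (le_max_right _ _).trans hs
  have h1 := h (δ⁻¹ * s) (by rw [inv_mul_eq_div, le_div_iff₀ hδ]; linarith) (l * δ)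
    (by positivity) (by nlinarith)
  rw [show l * δ * (δ⁻¹ * s) = l * s by field_simp] at h1
  have h2 := (div_lt_iff₀ (hpos s (by linarith))).1 (hs0 s hs1)
  calc _ ≤ _ := h1
    _ ≤ K * ((δ⁻¹ ^ α + 1) * q s) := by gcongr
    _ = _ := by ring

/-- A Potter-type bound. -/
theorem RadialExponent.exists_potter (hq : RadialExponent q)
    (hpos : ∀ s, 0 < s → 0 < q s)
    (hreg : ∀ l, 0 < l → Tendsto (fun s => q (l * s) / q s) atTop (𝓝 (l ^ α)))
    {γ : ℝ} (hγ0 : 0 < γ) (hγ : γ < α) :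
    ∃ C B : ℝ, 0 < C ∧ 0 < B ∧ ∀ s, B ≤ s → ∀ u, 0 < u → u ≤ 1 → B ≤ u * s → ∀ m, 0 ≤ m →
      q (m * (u * s)) ≤ C * (1 + m) ^ 2 * u ^ γ * q s := by
  obtain ⟨K, B₁, hK, hB₁, h1⟩ := hq.exists_le_mul hpos hreg
  have hlt : (2⁻¹ : ℝ) ^ α < 2⁻¹ ^ γ :=
    Real.rpow_lt_rpow_of_exponent_gt (by norm_num) (by norm_num) hγ
  obtain ⟨B₂, hB₂⟩ := eventually_atTop.1
    ((hreg 2⁻¹ (by norm_num)).eventually_lt_const hlt)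
  set B := max B₁ B₂ with hBdef
  have hB : 0 < B := lt_max_of_lt_left hB₁
  have hhalf : ∀ s, B ≤ s → q (2⁻¹ * s) ≤ 2⁻¹ ^ γ * q s := fun s hs =>
    ((div_lt_iff₀ (hpos s (hB.trans_le hs))).1 (hB₂ s ((le_max_right _ _).trans hs))).le
  have hiter : ∀ n : ℕ, ∀ s, B ≤ 2⁻¹ ^ n * s → q (2⁻¹ ^ n * s) ≤ (2⁻¹ ^ γ) ^ n * q s := by
    intro n
    induction n with
    | zero => intro s _; simp
    | succ k ih =>
      intro s hs
      have e : (2⁻¹ : ℝ) ^ (k + 1) * s = 2⁻¹ * (2⁻¹ ^ k * s) := by ring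
      have hks : B ≤ 2⁻¹ ^ k * s := by rw [e] at hs; linarith
      rw [e]
      calc _ ≤ _ := hhalf _ hks
        _ ≤ 2⁻¹ ^ γ * ((2⁻¹ ^ γ) ^ k * q s) := by gcongr; exact ih s hks
        _ = _ := by ring
  have hm : ∀ s, B ≤ s → ∀ m, 0 ≤ m → q (m * s) ≤ K * (1 + m) ^ 2 * q s := by
    intro s hs m hm
    set n := ⌊m⌋₊ + 1
    have hn0 : (0 : ℝ) < n := by positivity
    have hn1 : m < n := by simpa [n] using Nat.lt_floor_add_one m
    have hn2 : (n : ℝ) ≤ 1 + m := by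
      have := Nat.floor_le hm
      simp only [n]; push_cast; linarith
    have e : m * s = n * (m / n * s) := by field_simp
    have hqs := hq.nonneg s
    calc q (m * s) = q (n * (m / n * s)) := by rw [← e]
      _ ≤ n ^ 2 * q (m / n * s) := hq.nat_mul_le n _
      _ ≤ n ^ 2 * (K * q s) := by
          gcongr
          exact h1 s ((le_max_left _ _).trans hs) _ (by positivity)
            ((div_le_one hn0).2 hn1.le)
      _ ≤ (1 + m) ^ 2 * (K * q s) := by gcongr
      _ = _ := by ring
  have hpot : ∀ s, B ≤ s → ∀ u, 0 < u → u ≤ 1 → B ≤ u * s →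
      q (u * s) ≤ K * 2 ^ γ * u ^ γ * q s := by
    intro s hs u hu0 hu1 hus
    obtain ⟨n, hn1, hn2⟩ := exists_nat_pow_near_of_lt_one hu0 hu1 (by norm_num : (0:ℝ) < 2⁻¹)
      (by norm_num)
    have hp : (0 : ℝ) < 2⁻¹ ^ n := by positivity
    have hs0 : 0 < s := hB.trans_le hs
    have hB' : B ≤ 2⁻¹ ^ n * s := hus.trans (by gcongr)
    have e : u * s = u / 2⁻¹ ^ n * (2⁻¹ ^ n * s) := by field_simp
    have hqs := hq.nonneg s
    have h2 : ((2⁻¹ : ℝ) ^ γ) ^ n ≤ 2 ^ γ * u ^ γ := by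
      rw [← Real.mul_rpow (by norm_num) hu0.le, ← Real.rpow_natCast, ← Real.rpow_mul (by norm_num),
        mul_comm γ, Real.rpow_mul (by norm_num), Real.rpow_natCast]
      gcongr
      rw [pow_succ] at hn1
      linarith
    calc q (u * s) = q (u / 2⁻¹ ^ n * (2⁻¹ ^ n * s)) := by rw [← e]
      _ ≤ K * q (2⁻¹ ^ n * s) := h1 _ ((le_max_left _ _).trans hB') _ (by positivity)
          ((div_le_one hp).2 hn2)
      _ ≤ K * ((2⁻¹ ^ γ) ^ n * q s) := by gcongr; exact hiter n s hB'
      _ ≤ K * ((2 ^ γ * u ^ γ) * q s) := by gcongr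
      _ = _ := by ring
  refine ⟨K * (K * 2 ^ γ), B, by positivity, hB, ?_⟩
  intro s hs u hu0 hu1 hus m hm0
  calc _ ≤ K * (1 + m) ^ 2 * q (u * s) := hm _ hus m hm0
    _ ≤ K * (1 + m) ^ 2 * (K * 2 ^ γ * u ^ γ * q s) := by
        gcongr; exact hpot s hs u hu0 hu1 hus
    _ = _ := by ring

theorem exists_mul_rpow_le_of_potter {γ C B : ℝ} (hC : 0 < C) (hB : 0 < B)
    (hpos : ∀ s, 0 < s → 0 < q s)
    (h : ∀ s, B ≤ s → ∀ u, 0 < u → u ≤ 1 → B ≤ u * s → ∀ m, 0 ≤ m →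
      q (m * (u * s)) ≤ C * (1 + m) ^ 2 * u ^ γ * q s) :
    ∃ c : ℝ, 0 < c ∧ ∀ s, B ≤ s → c * s ^ γ ≤ q s := by
  refine ⟨q B / (C * 4 * B ^ γ), by have := hpos B hB; positivity, fun s hs => ?_⟩
  have hs0 : 0 < s := hB.trans_le hs
  have := h s hs (B / s) (by positivity) ((div_le_one hs0).2 hs)
    (by rw [div_mul_cancel₀ _ hs0.ne']) 1 zero_le_one
  rw [div_mul_cancel₀ _ hs0.ne', one_mul, Real.div_rpow hB.le hs0.le] at this
  have h1 : 0 < B ^ γ := by positivity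
  have h2 : 0 < s ^ γ := by positivity
  rw [div_mul_eq_mul_div, div_le_iff₀ (by positivity)]
  calc q B * s ^ γ ≤ (C * (1 + 1) ^ 2 * (B ^ γ / s ^ γ) * q s) * s ^ γ := by gcongr
    _ = _ := by field_simp; ring

/-- For a continuous profile, the generalized inverse of the running supremum is attained. -/
theorem generalizedInverse_spec {ψ₀ ψs ψinv : ℝ → ℝ} (hc : ContinuousOn ψ₀ (Set.Ici 0))
    (h0 : ψ₀ 0 = 0) (hψs : ∀ u, ψs u = sSup (ψ₀ '' Set.Icc 0 u))
    (hψinv : ∀ u, ψinv u = sInf {x : ℝ | 0 ≤ x ∧ u ≤ ψs x})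
    {v : ℝ} (hv : 0 < v) (hex : ∃ s, 0 ≤ s ∧ v ≤ ψ₀ s) :
    0 < ψinv v ∧ ψ₀ (ψinv v) = v ∧ ∀ x, 0 ≤ x → x < ψinv v → ψ₀ x < v := by
  set T := Set.Ici (0 : ℝ) ∩ ψ₀ ⁻¹' Set.Ici v with hT
  have hTc : IsClosed T := hc.preimage_isClosed_of_isClosed isClosed_Ici isClosed_Ici
  have hTn : T.Nonempty := let ⟨s, hs, hvs⟩ := hex; ⟨s, hs, hvs⟩
  have hTb : BddBelow T := ⟨0, fun x hx => hx.1⟩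
  have hmem : sInf T ∈ T := hTc.csInf_mem hTn hTb
  have heq : {x : ℝ | 0 ≤ x ∧ v ≤ ψs x} = Set.Ici (sInf T) := by
    ext x
    simp only [Set.mem_ofPred_eq, Set.mem_Ici]
    constructor
    · rintro ⟨hx, hvx⟩
      obtain ⟨y, hy, hys⟩ := isCompact_Icc.exists_sSup_image_eq (Set.nonempty_Icc.2 hx)
        (hc.mono Set.Icc_subset_Ici_self)
      rw [hψs, hys] at hvx
      exact (csInf_le hTb ⟨hy.1, hvx⟩).trans hy.2
    · intro hx
      have hx0 : 0 ≤ x := le_trans hmem.1 hx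
      refine ⟨hx0, ?_⟩
      rw [hψs]
      exact le_trans hmem.2 (le_csSup (isCompact_Icc.image_of_continuousOn
        (hc.mono Set.Icc_subset_Ici_self)).bddAbove ⟨_, ⟨hmem.1, hx⟩, rfl⟩)
  have hinv : ψinv v = sInf T := by rw [hψinv, heq, csInf_Ici]
  have hlt : ∀ x, 0 ≤ x → x < sInf T → ψ₀ x < v := by
    intro x hx hxT
    by_contra! hcon
    exact absurd (csInf_le hTb ⟨hx, hcon⟩) (not_le.2 hxT)
  have hne : sInf T ≠ 0 := fun h => by
    have := hmem.2
    rw [h, Set.mem_preimage, h0] at this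
    exact absurd hv (not_lt.2 this)
  have hpos : 0 < sInf T := lt_of_le_of_ne hmem.1 hne.symm
  rw [hinv]
  refine ⟨hpos, le_antisymm ?_ hmem.2, hlt⟩
  have hcw : Tendsto ψ₀ (𝓝[Set.Ico 0 (sInf T)] (sInf T)) (𝓝 (ψ₀ (sInf T))) :=
    (hc _ hmem.1).mono Set.Ico_subset_Ici_self
  have : (𝓝[Set.Ico 0 (sInf T)] (sInf T)).NeBot := by
    rw [← mem_closure_iff_nhdsWithin_neBot, closure_Ico hpos.ne]
    exact Set.right_mem_Icc.2 hpos.le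
  exact le_of_tendsto hcw (eventually_nhdsWithin_of_forall fun x hx => (hlt x hx.1 hx.2).le)

end RegularVariation

section SphericalAverage

variable {E : Type*} [NormedAddCommGroup E] [InnerProductSpace ℝ E] [FiniteDimensional ℝ E]
  [MeasurableSpace E] [BorelSpace E]

omit [FiniteDimensional ℝ E] [MeasurableSpace E] [BorelSpace E] in
theorem exists_linearIsometryEquiv_apply_eq {u v : E} (h : ‖u‖ = ‖v‖) :
    ∃ R : E ≃ₗᵢ[ℝ] E, R u = v :=
  ⟨_, Submodule.reflection_sub h⟩

/-- The action of a linear isometry on the unit sphere. -/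
def sphereMap (R : E ≃ₗᵢ[ℝ] E) (θ : sphere (0 : E) 1) : sphere (0 : E) 1 :=
  ⟨R θ, by simp⟩

open scoped Pointwise in
theorem measurePreserving_sphereMap (R : E ≃ₗᵢ[ℝ] E) :
    MeasurePreserving (sphereMap R) (volume : Measure E).toSphere (volume : Measure E).toSphere := by
  have hm : Measurable (sphereMap R) :=
    (R.continuous.measurable.comp measurable_subtype_coe).subtype_mk
  refine ⟨hm, Measure.ext fun s hs => ?_⟩
  rw [Measure.map_apply hm hs, Measure.toSphere_apply' _ hs, Measure.toSphere_apply' _ (hm hs)]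
  congr 1
  have hpre : Set.Ioo (0 : ℝ) 1 • ((↑) '' (sphereMap R ⁻¹' s) : Set E) =
      R ⁻¹' (Set.Ioo (0 : ℝ) 1 • ((↑) '' s : Set E)) := by
    ext x
    simp only [Set.mem_preimage, Set.mem_smul, Set.mem_image]
    constructor
    · rintro ⟨a, ha, _, ⟨θ, hθ, rfl⟩, rfl⟩
      exact ⟨a, ha, _, ⟨_, hθ, rfl⟩, by simp [sphereMap]⟩
    · rintro ⟨a, ha, _, ⟨θ, hθ, rfl⟩, hx⟩
      refine ⟨a, ha, _, ⟨sphereMap R.symm θ, ?_, rfl⟩, ?_⟩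
      · have : sphereMap R (sphereMap R.symm θ) = θ := by
          ext; simp [sphereMap]
        rwa [this]
      · apply R.injective
        simp [sphereMap, hx]
  rw [hpre]
  exact R.measurePreserving.measure_preimage_equiv (f := R.toMeasurableEquiv) _

theorem integral_sphere_inner_congr {G : Type*} [NormedAddCommGroup G] [NormedSpace ℝ G]
    (h : ℝ → G) {u v : E} (huv : ‖u‖ = ‖v‖) :
    ∫ θ : sphere (0 : E) 1, h ⟪u, (θ : E)⟫ ∂(volume : Measure E).toSphere =
      ∫ θ : sphere (0 : E) 1, h ⟪v, (θ : E)⟫ ∂(volume : Measure E).toSphere := by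
  obtain ⟨R, rfl⟩ := exists_linearIsometryEquiv_apply_eq huv
  have hR := measurePreserving_sphereMap R
  have hemb : MeasurableEmbedding (sphereMap R) := by
    refine MeasurableEmbedding.of_measurable_inverse (g := sphereMap R.symm) hR.measurable ?_
      (measurePreserving_sphereMap R.symm).measurable fun θ => ?_
    · rw [Set.range_eq_univ.2]
      · exact MeasurableSet.univ
      · exact fun θ => ⟨sphereMap R.symm θ, by ext; simp [sphereMap]⟩
    · ext; simp [sphereMap]
  conv_rhs => rw [← hR.integral_comp hemb]
  simp [sphereMap]

/-- A probability measure with radial characteristic function integrates bounded functions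
through their spherical averages. -/
theorem integral_eq_integral_sphere_average [Nontrivial E] (p : Measure E) [IsProbabilityMeasure p]
    (hp : ∀ u v : E, ‖u‖ = ‖v‖ → charFun p u = charFun p v)
    {f : E → ℝ} (hf : Measurable f) {C : ℝ} (hC : ∀ x, |f x| ≤ C) :
    ∫ y, f y ∂p = ∫ y, (⨍ θ : sphere (0 : E) 1, f (‖y‖ • (θ : E))
      ∂(volume : Measure E).toSphere) ∂p := by
  set σ := (volume : Measure E).toSphere
  have hσ : NeZero σ := ⟨Measure.toSphere_ne_zero _⟩
  set τ := (σ Set.univ)⁻¹ • σ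
  let T : E × sphere (0 : E) 1 → E := fun z => ‖z.1‖ • (z.2 : E)
  have hT : Measurable T := by fun_prop
  have hmap : (p.prod τ).map T = p := by
    have : IsFiniteMeasure ((p.prod τ).map T) := by infer_instance
    refine Measure.ext_of_charFun ?_
    ext ξ
    have hint : Integrable (fun z : E × sphere (0 : E) 1 =>
        Complex.exp (⟪T z, ξ⟫ * Complex.I)) (p.prod τ) :=
      Integrable.of_bound (by fun_prop) 1 (.of_forall fun z => by
        simp [Complex.norm_exp_ofReal_mul_I])
    have hint2 : Integrable (fun z : E × sphere (0 : E) 1 =>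
        Complex.exp (⟪z.1, ‖ξ‖ • (z.2 : E)⟫ * Complex.I)) (p.prod τ) :=
      Integrable.of_bound (by fun_prop) 1 (.of_forall fun z => by
        simp [Complex.norm_exp_ofReal_mul_I])
    rw [charFun_apply, integral_map hT.aemeasurable (by fun_prop), integral_prod _ hint]
    calc ∫ y, ∫ θ, Complex.exp (⟪T (y, θ), ξ⟫ * Complex.I) ∂τ ∂p
        = ∫ y, ∫ θ, Complex.exp (⟪y, ‖ξ‖ • (θ : E)⟫ * Complex.I) ∂τ ∂p := by
          refine integral_congr_ae (.of_forall fun y => ?_)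
          simp only [T, τ, integral_smul_measure]
          congr 1
          have := integral_sphere_inner_congr
            (fun s : ℝ => Complex.exp (s * Complex.I)) (u := ‖y‖ • ξ) (v := ‖ξ‖ • y)
            (by simp [norm_smul, mul_comm])
          simpa [real_inner_smul_left, real_inner_smul_right, real_inner_comm] using this
      _ = ∫ θ, ∫ y, Complex.exp (⟪y, ‖ξ‖ • (θ : E)⟫ * Complex.I) ∂p ∂τ :=
          integral_integral_swap hint2
      _ = ∫ θ, charFun p ξ ∂τ := by
          refine integral_congr_ae (.of_forall fun θ => ?_)
          simp only [← charFun_apply]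
          exact hp _ _ (by simp [norm_smul])
      _ = charFun p ξ := by simp
  have hint : Integrable (fun z => f (T z)) (p.prod τ) :=
    Integrable.of_bound (hf.comp hT).aestronglyMeasurable C (.of_forall fun z => hC _)
  calc ∫ y, f y ∂p = ∫ y, f y ∂(p.prod τ).map T := by rw [hmap]
    _ = ∫ z, f (T z) ∂p.prod τ := integral_map hT.aemeasurable hf.aestronglyMeasurable
    _ = _ := by rw [integral_prod _ hint]; rfl

theorem integral_neg_eq_of_charFun_radial (p : Measure E) [IsProbabilityMeasure p]
    (hp : ∀ u v : E, ‖u‖ = ‖v‖ → charFun p u = charFun p v) (f : E → ℝ) :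
    ∫ y, f (-y) ∂p = ∫ y, f y ∂p := by
  have hmap : p.map (fun y => -y) = p := by
    have : IsFiniteMeasure (p.map (fun y => -y)) := by infer_instance
    refine Measure.ext_of_charFun ?_
    ext ξ
    have := charFun_map_smul (μ := p) (-1) ξ
    simp only [neg_smul, one_smul] at this
    rw [this]
    exact hp _ _ (norm_neg ξ)
  conv_rhs => rw [← hmap]
  exact (integral_map_equiv (MeasurableEquiv.neg E) f).symm

end SphericalAverage

section RadialIntegrals

theorem integrableOn_ite_rpow {β γ : ℝ} (hβ : 0 < β) (hγ : β < γ) :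
    IntegrableOn (fun s : ℝ => if s ≤ 1 then s ^ (γ - 1 - β) else s ^ (-1 - β)) (Set.Ioi 0) := by
  rw [← Set.Ioc_union_Ioi_eq_Ioi (zero_le_one (α := ℝ))]
  refine IntegrableOn.union ?_ ?_
  · have h : IntegrableOn (fun s : ℝ => s ^ (γ - 1 - β)) (Set.Ioc 0 1) :=
      (intervalIntegrable_iff_integrableOn_Ioc_of_le zero_le_one).1
        (intervalIntegral.intervalIntegrable_rpow' (by linarith))
    exact h.congr_fun (fun s hs => by simp [hs.2]) measurableSet_Ioc
  · have h : IntegrableOn (fun s : ℝ => s ^ (-1 - β)) (Set.Ioi 1) :=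
      integrableOn_Ioi_rpow_of_lt (by linarith) one_pos
    exact h.congr_fun (fun s hs => by simp [not_le.2 (Set.mem_Ioi.1 hs)]) measurableSet_Ioi

theorem one_sub_exp_neg_mem {x : ℝ} (hx : 0 ≤ x) :
    0 ≤ 1 - Real.exp (-x) ∧ 1 - Real.exp (-x) ≤ 1 ∧ 1 - Real.exp (-x) ≤ x := by
  refine ⟨by simpa using hx, by linarith [Real.exp_pos (-x)], by linarith [Real.add_one_le_exp (-x)]⟩

theorem one_sub_exp_mul_rpow_le {α β m s : ℝ} (hm : 0 ≤ m) (hs : 0 < s) :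
    (1 - Real.exp (-(s * m) ^ α)) * s ^ (-1 - β) ≤
      (if s ≤ 1 then s ^ (α - 1 - β) else s ^ (-1 - β)) * (1 + m ^ α) := by
  have h := one_sub_exp_neg_mem (x := (s * m) ^ α) (by positivity)
  have hmα : 0 ≤ m ^ α := by positivity
  have hsβ : 0 < s ^ (-1 - β) := by positivity
  split_ifs with h1
  · rw [show α - 1 - β = α + (-1 - β) by ring, Real.rpow_add hs]
    have : (1 - Real.exp (-(s * m) ^ α)) ≤ s ^ α * (1 + m ^ α) := by
      refine h.2.2.trans ?_
      rw [Real.mul_rpow hs.le hm]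
      gcongr
      linarith
    calc _ ≤ s ^ α * (1 + m ^ α) * s ^ (-1 - β) := by gcongr
      _ = _ := by ring
  · nlinarith [h.2.1]

theorem integrableOn_one_sub_exp_mul_rpow {α β m : ℝ} (hβ : 0 < β) (hα : β < α) (hm : 0 ≤ m) :
    IntegrableOn (fun s : ℝ => (1 - Real.exp (-(s * m) ^ α)) * s ^ (-1 - β)) (Set.Ioi 0) := by
  refine ((integrableOn_ite_rpow hβ hα).mul_const (1 + m ^ α)).mono'
    (Measurable.aestronglyMeasurable (by fun_prop)) ?_
  refine (ae_restrict_iff' measurableSet_Ioi).2 (.of_forall fun s hs => ?_)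
  have hs : 0 < s := hs
  rw [Real.norm_of_nonneg]
  · exact one_sub_exp_mul_rpow_le hm hs
  · exact mul_nonneg (one_sub_exp_neg_mem (by positivity)).1 (by positivity)

theorem integral_one_sub_exp_rpow_mul_rpow {α β : ℝ} (hβ : 0 < β) (hα : β < α) :
    ∫ s in Set.Ioi (0 : ℝ), (1 - Real.exp (-s ^ α)) * s ^ (-1 - β) =
      Real.Gamma (1 - β / α) / β := by
  have hα0 : 0 < α := hβ.trans hα
  have hu : ∀ s ∈ Set.Ioi (0 : ℝ), HasDerivAt (fun s : ℝ => 1 - Real.exp (-s ^ α))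
      (α * s ^ (α - 1) * Real.exp (-s ^ α)) s := fun s hs => by
    have := ((Real.hasDerivAt_rpow_const (p := α) (Or.inl (ne_of_gt hs))).neg.exp).const_sub 1
    exact this.congr_deriv (by simp only [Pi.neg_apply]; ring)
  have hv : ∀ s ∈ Set.Ioi (0 : ℝ), HasDerivAt (fun s : ℝ => -s ^ (-β) / β) (s ^ (-1 - β)) s :=
    fun s hs => by
    have := ((Real.hasDerivAt_rpow_const (p := -β) (Or.inl (ne_of_gt hs))).neg).div_const β
    exact this.congr_deriv (by rw [show -β - 1 = -1 - β by ring]; field_simp)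
  have hmain : Set.EqOn (fun s : ℝ => α * s ^ (α - 1) * Real.exp (-s ^ α) * (-s ^ (-β) / β))
      (fun s : ℝ => -(α / β) * (s ^ (α - 1 - β) * Real.exp (-s ^ α))) (Set.Ioi 0) :=
    fun s hs => by
    simp only
    rw [show α - 1 - β = (α - 1) + -β by ring, Real.rpow_add hs]
    ring
  have huv : IntegrableOn (fun s : ℝ => (1 - Real.exp (-s ^ α)) * s ^ (-1 - β)) (Set.Ioi 0) := by
    simpa using integrableOn_one_sub_exp_mul_rpow hβ hα zero_le_one
  have hvu : IntegrableOn (fun s : ℝ => α * s ^ (α - 1) * Real.exp (-s ^ α) * (-s ^ (-β) / β))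
      (Set.Ioi 0) := by
    refine IntegrableOn.congr_fun ?_ hmain.symm measurableSet_Ioi
    exact (integrableOn_rpow_mul_exp_neg_rpow (by linarith) hα0).const_mul _
  have hbd : ∀ s : ℝ, 0 < s → ‖(1 - Real.exp (-s ^ α)) * (-s ^ (-β) / β)‖ ≤ s ^ (-β) / β ∧
      ‖(1 - Real.exp (-s ^ α)) * (-s ^ (-β) / β)‖ ≤ s ^ (α - β) / β := fun s hs => by
    have h := one_sub_exp_neg_mem (x := s ^ α) (by positivity)
    have hsβ : 0 < s ^ (-β) := by positivity
    rw [norm_mul, Real.norm_of_nonneg h.1, neg_div, norm_neg, Real.norm_of_nonneg (by positivity)]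
    refine ⟨mul_le_of_le_one_left (by positivity) h.2.1, ?_⟩
    rw [sub_eq_add_neg α, Real.rpow_add hs, mul_div_assoc]
    gcongr
    exact h.2.2
  have hz : Tendsto ((fun s : ℝ => 1 - Real.exp (-s ^ α)) * fun s : ℝ => -s ^ (-β) / β)
      (𝓝[>] 0) (𝓝 0) := by
    refine squeeze_zero_norm' (eventually_nhdsWithin_of_forall fun s hs => (hbd s hs).2) ?_
    have : Tendsto (fun s : ℝ => s ^ (α - β) / β) (𝓝 0) (𝓝 ((0 : ℝ) ^ (α - β) / β)) :=
      ((Real.continuousAt_rpow_const 0 (α - β) (Or.inr (by linarith))).tendsto).div_const β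
    rw [Real.zero_rpow (by linarith), zero_div] at this
    exact this.mono_left nhdsWithin_le_nhds
  have hi : Tendsto ((fun s : ℝ => 1 - Real.exp (-s ^ α)) * fun s : ℝ => -s ^ (-β) / β)
      atTop (𝓝 0) := by
    refine squeeze_zero_norm' ((eventually_gt_atTop 0).mono fun s hs => (hbd s hs).1) ?_
    simpa using (tendsto_rpow_neg_atTop hβ).div_const β
  rw [integral_Ioi_mul_deriv_eq_deriv_mul hu hv huv hvu hz hi,
    setIntegral_congr_fun measurableSet_Ioi hmain, integral_const_mul,
    integral_rpow_mul_exp_neg_rpow hα0 (by linarith),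
    show (α - 1 - β + 1) / α = 1 - β / α by field_simp; ring]
  field_simp
  ring

theorem integral_one_sub_exp_mul_rpow {α β m : ℝ} (hβ : 0 < β) (hα : β < α) (hm : 0 ≤ m) :
    ∫ s in Set.Ioi (0 : ℝ), (1 - Real.exp (-(s * m) ^ α)) * s ^ (-1 - β) =
      m ^ β * (Real.Gamma (1 - β / α) / β) := by
  rcases hm.eq_or_lt with rfl | hm
  · simp [Real.zero_rpow hβ.ne', Real.zero_rpow (hβ.trans hα).ne']
  · have h := integral_comp_mul_left_Ioi
      (fun s : ℝ => (1 - Real.exp (-s ^ α)) * s ^ (-1 - β)) 0 hm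
    rw [mul_zero, integral_one_sub_exp_rpow_mul_rpow hβ hα, smul_eq_mul, inv_mul_eq_div,
      eq_div_iff hm.ne'] at h
    rw [← h, ← integral_mul_const, ← integral_const_mul]
    refine setIntegral_congr_fun measurableSet_Ioi fun s hs => ?_
    have hs : 0 < s := hs
    rw [Real.mul_rpow (z := -1 - β) hm.le hs.le, mul_comm s m, sub_eq_add_neg (-1), Real.rpow_add hm,
      Real.rpow_neg hm.le β, Real.rpow_neg_one]
    field_simp

/-- A bounded radial profile which behaves like a multiple of `x ^ β` at the origin. -/
noncomputable def truncatedPower (β B x : ℝ) : ℝ :=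
  ∫ s in Set.Ioi B, (1 - Real.exp (-(s * x) ^ 2)) * s ^ (-1 - β)

variable {β B : ℝ}

theorem integrableOn_one_sub_exp_sq (hβ : 0 < β) (hβ2 : β < 2) {x : ℝ} (hx : 0 ≤ x) :
    IntegrableOn (fun s : ℝ => (1 - Real.exp (-(s * x) ^ 2)) * s ^ (-1 - β)) (Set.Ioi 0) := by
  simpa using integrableOn_one_sub_exp_mul_rpow hβ hβ2 hx

theorem truncatedPower_nonneg (hB : 0 < B) (x : ℝ) : 0 ≤ truncatedPower β B x :=
  setIntegral_nonneg measurableSet_Ioi fun _ hs =>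
    mul_nonneg (one_sub_exp_neg_mem (sq_nonneg _)).1 (Real.rpow_nonneg (hB.trans hs).le _)

theorem truncatedPower_zero : truncatedPower β B 0 = 0 := by
  simp [truncatedPower]

theorem truncatedPower_le (hβ : 0 < β) (hβ2 : β < 2) (hB : 0 < B) {x : ℝ} (hx : 0 ≤ x) :
    truncatedPower β B x ≤ B ^ (-β) / β := by
  have hint : IntegrableOn (fun s : ℝ => s ^ (-1 - β)) (Set.Ioi B) :=
    integrableOn_Ioi_rpow_of_lt (by linarith) hB
  have h := integral_Ioi_rpow_of_lt (a := -1 - β) (by linarith) hB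
  rw [show B ^ (-β) / β = -B ^ (-1 - β + 1) / (-1 - β + 1) by
    rw [show -1 - β + 1 = -β by ring, neg_div_neg_eq], ← h]
  refine setIntegral_mono_on ((integrableOn_one_sub_exp_sq hβ hβ2 hx).mono_set
    (Set.Ioi_subset_Ioi hB.le)) hint measurableSet_Ioi fun _ hs => ?_
  exact mul_le_of_le_one_left (Real.rpow_nonneg (hB.trans hs).le _)
    (one_sub_exp_neg_mem (sq_nonneg _)).2.1

theorem abs_truncatedPower_sub_le (hβ : 0 < β) (hβ2 : β < 2) (hB : 0 < B) {x : ℝ} (hx : 0 ≤ x) :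
    |Real.Gamma (1 - β / 2) / β * x ^ β - truncatedPower β B x| ≤
      x ^ 2 * (B ^ (2 - β) / (2 - β)) := by
  have hint := integrableOn_one_sub_exp_sq hβ hβ2 hx
  have h := integral_one_sub_exp_mul_rpow hβ hβ2 hx
  simp only [Real.rpow_two] at h
  rw [← Set.Ioc_union_Ioi_eq_Ioi hB.le, setIntegral_union (Set.Ioc_disjoint_Ioi le_rfl)
    measurableSet_Ioi (hint.mono_set Set.Ioc_subset_Ioi_self)
    (hint.mono_set (Set.Ioi_subset_Ioi hB.le))] at h
  have e : Real.Gamma (1 - β / 2) / β * x ^ β - truncatedPower β B x =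
      ∫ s in Set.Ioc 0 B, (1 - Real.exp (-(s * x) ^ 2)) * s ^ (-1 - β) := by
    rw [mul_comm, ← h, truncatedPower, add_sub_cancel_right]
  rw [e, abs_of_nonneg (setIntegral_nonneg measurableSet_Ioc fun s hs =>
    mul_nonneg (one_sub_exp_neg_mem (sq_nonneg _)).1 (Real.rpow_nonneg hs.1.le _))]
  have hint2 : IntegrableOn (fun s : ℝ => s ^ (1 - β)) (Set.Ioc 0 B) :=
    (intervalIntegrable_iff_integrableOn_Ioc_of_le hB.le).1
      (intervalIntegral.intervalIntegrable_rpow' (by linarith))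
  have h2 : ∫ s in Set.Ioc 0 B, s ^ (1 - β) = B ^ (2 - β) / (2 - β) := by
    rw [← intervalIntegral.integral_of_le hB.le, integral_rpow (Or.inl (by linarith)),
      show 1 - β + 1 = 2 - β by ring, Real.zero_rpow (by linarith), sub_zero]
  rw [← h2, ← integral_const_mul]
  refine setIntegral_mono_on (hint.mono_set Set.Ioc_subset_Ioi_self) (hint2.const_mul _)
    measurableSet_Ioc fun s hs => ?_
  have hs0 : 0 < s := hs.1
  calc _ ≤ (s * x) ^ 2 * s ^ (-1 - β) := by
        gcongr; exact (one_sub_exp_neg_mem (sq_nonneg _)).2.2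
    _ = x ^ 2 * (s ^ (2 : ℝ) * s ^ (-1 - β)) := by rw [Real.rpow_two]; ring
    _ = _ := by rw [← Real.rpow_add hs0]; ring_nf

theorem tendsto_truncatedPower_div (hβ : 0 < β) (hβ2 : β < 2) (hB : 0 < B) :
    Tendsto (fun x => truncatedPower β B x / x ^ β) (𝓝[>] 0)
      (𝓝 (Real.Gamma (1 - β / 2) / β)) := by
  rw [← tendsto_sub_nhds_zero_iff]
  have hz : Tendsto (fun x : ℝ => x ^ (2 - β) * (B ^ (2 - β) / (2 - β))) (𝓝[>] 0) (𝓝 0) := by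
    have : Tendsto (fun x : ℝ => x ^ (2 - β) * (B ^ (2 - β) / (2 - β))) (𝓝 0)
        (𝓝 ((0 : ℝ) ^ (2 - β) * (B ^ (2 - β) / (2 - β)))) :=
      ((Real.continuousAt_rpow_const 0 (2 - β) (Or.inr (by linarith))).tendsto).mul_const _
    rw [Real.zero_rpow (by linarith), zero_mul] at this
    exact this.mono_left nhdsWithin_le_nhds
  refine squeeze_zero_norm' (eventually_nhdsWithin_of_forall fun x hx => ?_) hz
  have hx : 0 < x := hx
  have h := abs_truncatedPower_sub_le hβ hβ2 hB hx.le
  have hxβ : 0 < x ^ β := by positivity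
  rw [Real.norm_eq_abs, abs_sub_comm, sub_div' hxβ.ne', abs_div, abs_of_pos hxβ, div_le_iff₀ hxβ]
  refine h.trans_eq ?_
  rw [show x ^ 2 = x ^ (2 - β) * x ^ β by
    rw [← Real.rpow_add hx, sub_add_cancel, Real.rpow_two]]
  ring

theorem measurable_truncatedPower : Measurable (truncatedPower β B) := by
  refine StronglyMeasurable.measurable ?_
  refine StronglyMeasurable.integral_prod_right (f := fun x s : ℝ =>
    (1 - Real.exp (-(s * x) ^ 2)) * s ^ (-1 - β)) ?_
  exact Measurable.stronglyMeasurable (by fun_prop)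

end RadialIntegrals

section Gaussian

variable (E : Type*) [NormedAddCommGroup E] [InnerProductSpace ℝ E] [FiniteDimensional ℝ E]
  [MeasurableSpace E] [BorelSpace E]

/-- The density of the centred Gaussian measure with characteristic function
`ξ ↦ exp (-‖ξ‖ ^ 2)`. -/
noncomputable def heatDensity (z : E) : ℝ :=
  (4 * Real.pi) ^ (-(Module.finrank ℝ E : ℝ) / 2) * Real.exp (-(1 / 4) * ‖z‖ ^ 2)

/-- The centred Gaussian measure with characteristic function `ξ ↦ exp (-‖ξ‖ ^ 2)`. -/
noncomputable def heatMeasure : Measure E :=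
  volume.withDensity fun z => ENNReal.ofReal (heatDensity E z)

variable {E}

omit [FiniteDimensional ℝ E] [MeasurableSpace E] [BorelSpace E] in
theorem heatDensity_nonneg (z : E) : 0 ≤ heatDensity E z := by
  unfold heatDensity; positivity

omit [FiniteDimensional ℝ E] in
@[fun_prop]
theorem measurable_heatDensity : Measurable (heatDensity E) := by
  unfold heatDensity; fun_prop

theorem integral_heatMeasure {G : Type*} [NormedAddCommGroup G] [NormedSpace ℝ G] (f : E → G) :
    ∫ z, f z ∂heatMeasure E = ∫ z, heatDensity E z • f z := by
  rw [heatMeasure, integral_withDensity_eq_integral_toReal_smul (by fun_prop)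
    (.of_forall fun _ => ENNReal.ofReal_lt_top)]
  simp [ENNReal.toReal_ofReal (heatDensity_nonneg _)]

theorem integrable_heatMeasure_iff {f : E → ℝ} :
    Integrable f (heatMeasure E) ↔ Integrable fun z => heatDensity E z * f z := by
  rw [heatMeasure, integrable_withDensity_iff_integrable_smul' (by fun_prop)
    (.of_forall fun _ => ENNReal.ofReal_lt_top)]
  simp [ENNReal.toReal_ofReal (heatDensity_nonneg _)]

theorem charFun_heatMeasure (ξ : E) :
    charFun (heatMeasure E) ξ = (Real.exp (-‖ξ‖ ^ 2) : ℂ) := by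
  rw [charFun_apply, integral_heatMeasure]
  have h := GaussianFourier.integral_cexp_neg_mul_sq_norm_add (V := E) (b := 1 / 4)
    (by norm_num) Complex.I ξ
  have hb : (Real.pi / (1 / 4) : ℂ) = ((4 * Real.pi : ℝ) : ℂ) := by push_cast; ring
  have hd : (Module.finrank ℝ E / 2 : ℂ) = ((Module.finrank ℝ E / 2 : ℝ) : ℂ) := by push_cast; ring
  rw [hb, hd, ← Complex.ofReal_cpow (by positivity)] at h
  calc ∫ z, heatDensity E z • Complex.exp (⟪z, ξ⟫ * Complex.I)
      = ∫ z : E, ((4 * Real.pi) ^ (-(Module.finrank ℝ E : ℝ) / 2) : ℝ) *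
          Complex.exp (-(1 / 4) * ‖z‖ ^ 2 + Complex.I * ⟪ξ, z⟫) := by
        refine integral_congr_ae (.of_forall fun z => ?_)
        simp only [heatDensity, Complex.real_smul, Complex.exp_add, real_inner_comm z ξ]
        push_cast
        rw [mul_comm (Complex.I)]
        ring
    _ = _ := by
        rw [integral_const_mul, h, ← mul_assoc, ← Complex.ofReal_mul,
          ← Real.rpow_add (by positivity)]
        simp [neg_div]

instance : IsProbabilityMeasure (heatMeasure E) where
  measure_univ := by
    have h := charFun_zero (heatMeasure E)
    rw [charFun_heatMeasure] at h
    have h' : (heatMeasure E).real Set.univ = 1 := by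
      have := h.symm
      norm_num at this
      exact_mod_cast this
    rw [measureReal_def] at h'
    rwa [← ENNReal.toReal_eq_one_iff]

theorem pow_mul_heat_radial {s : ℝ} (n : ℕ) (hn : 1 ≤ n) {y : ℝ} (hy : 0 < y) :
    y ^ (n - 1) * (Real.exp (-(1 / 4) * y ^ 2) * y ^ s) =
      y ^ (n - 1 + s : ℝ) * Real.exp (-(1 / 4) * y ^ (2 : ℝ)) := by
  rw [Real.rpow_add hy, show ((n : ℝ) - 1) = ((n - 1 : ℕ) : ℝ) by simp [Nat.cast_sub hn],
    Real.rpow_natCast, Real.rpow_two]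
  ring

theorem integrable_norm_rpow_heatMeasure [Nontrivial E] {s : ℝ} (hs : 0 ≤ s) :
    Integrable (fun z : E => ‖z‖ ^ s) (heatMeasure E) := by
  rw [integrable_heatMeasure_iff]
  simp only [heatDensity, mul_assoc]
  refine Integrable.const_mul ?_ _
  rw [integrable_fun_norm_addHaar volume (f := fun y => Real.exp (-(1 / 4) * y ^ 2) * y ^ s)]
  have hn : 1 ≤ Module.finrank ℝ E := Module.finrank_pos
  have hn' : (1 : ℝ) ≤ Module.finrank ℝ E := by exact_mod_cast hn
  refine IntegrableOn.congr_fun (f := fun y : ℝ => y ^ (Module.finrank ℝ E - 1 + s : ℝ) *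
    Real.exp (-(1 / 4) * y ^ (2 : ℝ))) ?_ (fun y hy => ?_) measurableSet_Ioi
  · exact integrableOn_rpow_mul_exp_neg_mul_rpow (by linarith) (by norm_num) (by norm_num)
  · exact (pow_mul_heat_radial _ hn hy).symm

theorem integral_norm_rpow_heatMeasure [Nontrivial E] {s : ℝ} (hs : 0 ≤ s) :
    ∫ z : E, ‖z‖ ^ s ∂heatMeasure E =
      (volume : Measure E).toSphere.real Set.univ * (Real.pi ^ (-(Module.finrank ℝ E : ℝ) / 2) *
        (4 : ℝ) ^ (s / 2) * Real.Gamma ((Module.finrank ℝ E + s) / 2) / 2) := by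
  have hn : 1 ≤ Module.finrank ℝ E := Module.finrank_pos
  have hn' : (1 : ℝ) ≤ Module.finrank ℝ E := by exact_mod_cast hn
  rw [integral_heatMeasure]
  simp only [heatDensity, mul_assoc, smul_eq_mul]
  rw [integral_const_mul,
    integral_fun_norm_addHaar volume (fun y => Real.exp (-(1 / 4) * y ^ 2) * y ^ s),
    Measure.toSphere_real_apply_univ]
  simp only [smul_eq_mul, nsmul_eq_mul]
  rw [setIntegral_congr_fun measurableSet_Ioi fun y hy => pow_mul_heat_radial _ hn hy,
    integral_rpow_mul_exp_neg_mul_rpow (by norm_num) (by linarith) (by norm_num)]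
  set n : ℝ := (Module.finrank ℝ E : ℝ)
  rw [show n - 1 + s + 1 = n + s by ring, Real.mul_rpow (by norm_num) Real.pi_pos.le,
    one_div, Real.inv_rpow (by norm_num), ← Real.rpow_neg (by norm_num),
    show -(-(n + s) / 2) = n / 2 + s / 2 by ring, Real.rpow_add (by norm_num),
    neg_div, Real.rpow_neg (x := 4) (by norm_num)]
  field_simp

/-- Gaussian subordination: exchanging the roles of a measure and its characteristic function. -/
theorem integral_exp_neg_sq_eq (p : Measure E) [IsProbabilityMeasure p] {φ : E → ℝ}
    (hφ : ∀ ξ, charFun p ξ = φ ξ) (s : ℝ) :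
    ∫ y, Real.exp (-(s * ‖y‖) ^ 2) ∂p = ∫ z, φ (s • z) ∂heatMeasure E := by
  have hint : Integrable (fun x : E × E => Complex.exp (⟪x.2, s • x.1⟫ * Complex.I))
      (p.prod (heatMeasure E)) :=
    Integrable.of_bound (by fun_prop) 1 (.of_forall fun z => by
      simp [Complex.norm_exp_ofReal_mul_I])
  have h := integral_integral_swap
    (f := fun y z : E => Complex.exp (⟪z, s • y⟫ * Complex.I)) hint
  have h1 : ∀ y : E, ∫ z, Complex.exp (⟪z, s • y⟫ * Complex.I) ∂heatMeasure E =
      (Real.exp (-(s * ‖y‖) ^ 2) : ℂ) := fun y => by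
    rw [← charFun_apply, charFun_heatMeasure, norm_smul, mul_pow, mul_pow, Real.norm_eq_abs,
      sq_abs]
  have h2 : ∀ z : E, ∫ y, Complex.exp (⟪z, s • y⟫ * Complex.I) ∂p = φ (s • z) := fun z => by
    rw [← hφ, charFun_apply]
    congr 1
    ext y
    rw [real_inner_smul_right, real_inner_smul_right, real_inner_comm]
  simp only [h1, h2] at h
  rw [integral_complex_ofReal, integral_complex_ofReal] at h
  exact_mod_cast h

end Gaussian

section Asymptotics

variable {E : Type*} [NormedAddCommGroup E] [InnerProductSpace ℝ E] [FiniteDimensional ℝ E]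
  [MeasurableSpace E] [BorelSpace E]

theorem integral_truncatedPower_eq {β B : ℝ} (hβ : 0 < β) (hB : 0 < B)
    (p : Measure E) [IsProbabilityMeasure p] {φ : E → ℝ} (hφ : ∀ ξ, charFun p ξ = φ ξ)
    (hφi : ∀ s : ℝ, Integrable (fun z => φ (s • z)) (heatMeasure E)) :
    ∫ y, truncatedPower β B ‖y‖ ∂p =
      ∫ s in Set.Ioi B, (∫ z, (1 - φ (s • z)) ∂heatMeasure E) * s ^ (-1 - β) := by
  have hint : Integrable (fun x : E × ℝ => (1 - Real.exp (-(x.2 * ‖x.1‖) ^ 2)) * x.2 ^ (-1 - β))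
      (p.prod (volume.restrict (Set.Ioi B))) := by
    have h1 : Integrable (fun x : E × ℝ => (1 : ℝ) * x.2 ^ (-1 - β))
        (p.prod (volume.restrict (Set.Ioi B))) :=
      (integrable_const (1 : ℝ)).mul_prod (integrableOn_Ioi_rpow_of_lt (by linarith) hB)
    refine h1.mono (Measurable.aestronglyMeasurable (by fun_prop)) (.of_forall fun x => ?_)
    have h2 := one_sub_exp_neg_mem (sq_nonneg (x.2 * ‖x.1‖))
    rw [norm_mul, norm_mul, Real.norm_of_nonneg h2.1, norm_one]
    exact mul_le_mul_of_nonneg_right h2.2.1 (norm_nonneg _)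
  have h := integral_integral_swap
    (f := fun (y : E) (s : ℝ) => (1 - Real.exp (-(s * ‖y‖) ^ 2)) * s ^ (-1 - β)) hint
  refine h.trans (integral_congr_ae (.of_forall fun s => ?_))
  simp only
  rw [integral_mul_const]
  congr 1
  have he : Integrable (fun y : E => Real.exp (-(s * ‖y‖) ^ 2)) p :=
    Integrable.of_bound (by fun_prop) 1 (.of_forall fun y => by
      rw [Real.norm_of_nonneg (Real.exp_pos _).le]
      simpa using sq_nonneg _)
  rw [integral_sub (integrable_const _) he, integral_sub (integrable_const _) (hφi s),
    integral_exp_neg_sq_eq p hφ s]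
  simp

theorem integral_heat_rpow_swap [Nontrivial E] {α β : ℝ} (hβ : 0 < β) (hα : β < α) :
    ∫ s in Set.Ioi (0 : ℝ), (∫ z : E, (1 - Real.exp (-(s * ‖z‖) ^ α)) ∂heatMeasure E) *
      s ^ (-1 - β) =
    (∫ z : E, ‖z‖ ^ β ∂heatMeasure E) * (Real.Gamma (1 - β / α) / β) := by
  have hint : Integrable (fun x : ℝ × E => (1 - Real.exp (-(x.1 * ‖x.2‖) ^ α)) * x.1 ^ (-1 - β))
      ((volume.restrict (Set.Ioi 0)).prod (heatMeasure E)) := by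
    have h1 := (integrableOn_ite_rpow hβ hα).mul_prod
      ((integrable_const (1 : ℝ)).add
        (integrable_norm_rpow_heatMeasure (E := E) (hβ.trans hα).le))
    refine h1.mono' (Measurable.aestronglyMeasurable (by fun_prop)) ?_
    have h0 : ∀ᵐ x : ℝ × E ∂(volume.restrict (Set.Ioi (0 : ℝ))).prod (heatMeasure E), 0 < x.1 :=
      Measure.quasiMeasurePreserving_fst.ae (ae_restrict_mem measurableSet_Ioi)
    filter_upwards [h0] with x hx
    rw [Real.norm_of_nonneg]
    · exact one_sub_exp_mul_rpow_le (norm_nonneg _) hx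
    · exact mul_nonneg (one_sub_exp_neg_mem (by positivity)).1 (by positivity)
  have h := integral_integral_swap
    (f := fun (s : ℝ) (z : E) => (1 - Real.exp (-(s * ‖z‖) ^ α)) * s ^ (-1 - β)) hint
  simp only [integral_mul_const] at h
  rw [h, ← integral_mul_const]
  refine integral_congr_ae (.of_forall fun z => ?_)
  exact integral_one_sub_exp_mul_rpow hβ hα (norm_nonneg z)

theorem tendsto_scaled_integral [Nontrivial E] {q b : ℝ → ℝ} {α β γ C B : ℝ}
    (hq : RadialExponent q)
    (hreg : ∀ l, 0 < l → Tendsto (fun s => q (l * s) / q s) atTop (𝓝 (l ^ α)))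
    (hβ : 0 < β) (hγ : β < γ) (hα : β < α) (hC : 0 < C) (hB : 0 < B)
    (hpotter : ∀ s, B ≤ s → ∀ u, 0 < u → u ≤ 1 → B ≤ u * s → ∀ m, 0 ≤ m →
      q (m * (u * s)) ≤ C * (1 + m) ^ 2 * u ^ γ * q s)
    (hb : Tendsto b (𝓝[>] 0) atTop) (hqb : ∀ᶠ t in 𝓝[>] 0, q (b t) = 1 / t) :
    Tendsto (fun t => b t ^ β * ∫ s in Set.Ioi B,
      (∫ z : E, (1 - Real.exp (-(t * q (s * ‖z‖)))) ∂heatMeasure E) * s ^ (-1 - β)) (𝓝[>] 0)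
      (𝓝 ((∫ z : E, ‖z‖ ^ β ∂heatMeasure E) * (Real.Gamma (1 - β / α) / β))) := by
  have hqc := hq.continuous
  set Φ : ℝ → ℝ → ℝ := fun t s => ∫ z : E, (1 - Real.exp (-(t * q (s * ‖z‖)))) ∂heatMeasure E
    with hΦ
  have htpos : ∀ᶠ t : ℝ in 𝓝[>] 0, 0 < t := eventually_mem_nhdsWithin
  have hbpos : ∀ᶠ t in 𝓝[>] 0, 0 < b t := hb.eventually_gt_atTop 0
  have hbB : ∀ᶠ t in 𝓝[>] 0, B ≤ b t := hb.eventually_ge_atTop B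
  have hmem : ∀ t : ℝ, 0 < t → ∀ x, 0 ≤ 1 - Real.exp (-(t * q x)) ∧
      1 - Real.exp (-(t * q x)) ≤ 1 ∧ 1 - Real.exp (-(t * q x)) ≤ t * q x := fun t ht x =>
    one_sub_exp_neg_mem (mul_nonneg ht.le (hq.nonneg x))
  have hinti : ∀ t : ℝ, 0 < t → ∀ s, Integrable (fun z : E => 1 - Real.exp (-(t * q (s * ‖z‖))))
      (heatMeasure E) := fun t ht s =>
    Integrable.of_bound (Continuous.aestronglyMeasurable (by fun_prop)) 1 (.of_forall fun z => by
      rw [Real.norm_of_nonneg (hmem t ht _).1]; exact (hmem t ht _).2.1)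
  have hΦ0 : ∀ t : ℝ, 0 < t → ∀ s, 0 ≤ Φ t s := fun t ht s =>
    integral_nonneg fun z => (hmem t ht _).1
  have hΦ1 : ∀ t : ℝ, 0 < t → ∀ s, Φ t s ≤ 1 := fun t ht s => by
    have := integral_mono (hinti t ht s) (integrable_const (1 : ℝ)) fun z => (hmem t ht _).2.1
    simpa using this
  have hI2 : Integrable (fun z : E => C * (1 + ‖z‖) ^ 2) (heatMeasure E) := by
    refine Integrable.const_mul ?_ _
    have h2 := integrable_norm_rpow_heatMeasure (E := E) (s := 2) (by norm_num)
    simp only [Real.rpow_two] at h2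
    refine ((integrable_const (2 : ℝ)).add (h2.const_mul 2)).mono'
      (Continuous.aestronglyMeasurable (by fun_prop)) (.of_forall fun z => ?_)
    rw [Real.norm_of_nonneg (by positivity)]
    simp only [Pi.add_apply]
    nlinarith [sq_nonneg (1 - ‖z‖)]
  set D := ∫ z : E, C * (1 + ‖z‖) ^ 2 ∂heatMeasure E
  have hD : 0 ≤ D := integral_nonneg fun z => by positivity
  have hΦγ : ∀ t, 0 < t → q (b t) = 1 / t → B ≤ b t → ∀ u, 0 < u → u ≤ 1 → B ≤ u * b t →
      Φ t (b t * u) ≤ D * u ^ γ := fun t ht hqt hBt u hu hu1 hub => by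
    rw [← integral_mul_const]
    refine integral_mono (hinti t ht _) (hI2.mul_const _) fun z => ?_
    refine (hmem t ht _).2.2.trans ?_
    have := hpotter (b t) hBt u hu hu1 hub ‖z‖ (norm_nonneg z)
    rw [show b t * u * ‖z‖ = ‖z‖ * (u * b t) by ring]
    calc _ ≤ t * (C * (1 + ‖z‖) ^ 2 * u ^ γ * q (b t)) := by gcongr
      _ = _ := by rw [hqt]; field_simp
  have hscale : ∀ᶠ t in 𝓝[>] 0, ∫ u in Set.Ioi 0,
      (Set.Ioi (B / b t)).indicator (fun u => Φ t (b t * u) * u ^ (-1 - β)) u =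
      b t ^ β * ∫ s in Set.Ioi B, Φ t s * s ^ (-1 - β) := by
    filter_upwards [hbpos] with t ht
    have hBb : 0 < B / b t := by positivity
    rw [setIntegral_indicator measurableSet_Ioi,
      Set.inter_eq_self_of_subset_right (Set.Ioi_subset_Ioi hBb.le)]
    have h := integral_comp_mul_left_Ioi (fun s => Φ t s * s ^ (-1 - β)) (B / b t) ht
    rw [mul_div_cancel₀ _ ht.ne', smul_eq_mul, inv_mul_eq_div, eq_div_iff ht.ne'] at h
    rw [← h, ← integral_mul_const, ← integral_const_mul]
    refine setIntegral_congr_fun measurableSet_Ioi fun u hu => ?_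
    have hu : 0 < u := hBb.trans hu
    rw [Real.mul_rpow ht.le hu.le, sub_eq_add_neg (-1), Real.rpow_add ht,
      Real.rpow_neg ht.le β, Real.rpow_neg_one]
    field_simp
  refine Tendsto.congr' hscale ?_
  rw [← integral_heat_rpow_swap hβ hα]
  refine tendsto_integral_filter_of_dominated_convergence
    (fun u => (D + 1) * if u ≤ 1 then u ^ (γ - 1 - β) else u ^ (-1 - β)) ?_ ?_
    ((integrableOn_ite_rpow hβ hγ).const_mul _) ?_
  · refine .of_forall fun t => ?_
    refine (StronglyMeasurable.indicator ?_ measurableSet_Ioi).aestronglyMeasurable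
    refine StronglyMeasurable.mul ?_ (Measurable.stronglyMeasurable (by fun_prop))
    refine StronglyMeasurable.integral_prod_right (f := fun (u : ℝ) (z : E) =>
      1 - Real.exp (-(t * q (b t * u * ‖z‖)))) ?_
    exact Continuous.stronglyMeasurable (by fun_prop)
  · filter_upwards [htpos, hbpos, hbB, hqb] with t ht hbt hBt hqt
    refine (ae_restrict_iff' measurableSet_Ioi).2 (.of_forall fun u hu => ?_)
    have hu : 0 < u := hu
    have hnn : 0 ≤ (D + 1) * if u ≤ 1 then u ^ (γ - 1 - β) else u ^ (-1 - β) := by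
      split_ifs <;> positivity
    by_cases huB : u ∈ Set.Ioi (B / b t)
    · rw [Set.indicator_of_mem huB, Real.norm_of_nonneg
        (mul_nonneg (hΦ0 t ht _) (by positivity))]
      have hub : B ≤ u * b t := ((div_lt_iff₀ hbt).1 huB).le
      split_ifs with h1
      · calc _ ≤ D * u ^ γ * u ^ (-1 - β) := by
              gcongr; exact hΦγ t ht hqt hBt u hu h1 hub
          _ = D * u ^ (γ - 1 - β) := by
              rw [mul_assoc, ← Real.rpow_add hu]; ring_nf
          _ ≤ _ := by gcongr; linarith
      · have := hΦ1 t ht (b t * u)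
        gcongr
        linarith
    · rw [Set.indicator_of_notMem huB, norm_zero]
      exact hnn
  · refine (ae_restrict_iff' measurableSet_Ioi).2 (.of_forall fun u hu => ?_)
    have hu : 0 < u := hu
    have hev : ∀ᶠ t in 𝓝[>] 0, Φ t (b t * u) * u ^ (-1 - β) =
        (Set.Ioi (B / b t)).indicator (fun u => Φ t (b t * u) * u ^ (-1 - β)) u := by
      filter_upwards [hbpos, hb.eventually_gt_atTop (B / u)] with t hbt hlt
      rw [Set.indicator_of_mem]
      rw [Set.mem_Ioi, div_lt_iff₀ hbt]
      rw [div_lt_iff₀ hu] at hlt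
      linarith
    refine Tendsto.congr' hev (Tendsto.mul_const _ ?_)
    refine tendsto_integral_filter_of_dominated_convergence (fun _ => 1) ?_ ?_
      (integrable_const _) ?_
    · exact .of_forall fun t => Continuous.aestronglyMeasurable (by fun_prop)
    · filter_upwards [htpos] with t ht
      refine .of_forall fun z => ?_
      rw [Real.norm_of_nonneg (hmem t ht _).1]
      exact (hmem t ht _).2.1
    · refine .of_forall fun z => ?_
      refine (Real.continuous_exp.tendsto _).comp (Tendsto.neg ?_) |>.const_sub 1
      rcases (norm_nonneg z).eq_or_lt with hz | hz
      · simp [← hz, hq.zero, Real.zero_rpow (hβ.trans hα).ne']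
      · refine Tendsto.congr' ?_ ((hreg (u * ‖z‖) (by positivity)).comp hb)
        filter_upwards [hqb, htpos] with t hqt ht
        simp only [Function.comp_apply, hqt]
        rw [show u * ‖z‖ * b t = b t * u * ‖z‖ by ring]
        field_simp

theorem abs_sub_le_of_tendsto_div {F G : ℝ → ℝ} {β A c M N : ℝ} (hc : 0 < c)
    (hF0 : F 0 = 0) (hG0 : G 0 = 0) (hF : ∀ x, 0 ≤ x → |F x| ≤ M) (hG : ∀ x, 0 ≤ x → |G x| ≤ N)
    (hFl : Tendsto (fun x => F x / x ^ β) (𝓝[>] 0) (𝓝 A))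
    (hGl : Tendsto (fun x => G x / x ^ β) (𝓝[>] 0) (𝓝 c)) {ε : ℝ} (hε : 0 < ε)
    (hGnn : ∀ x, 0 ≤ G x) :
    ∃ K : ℝ, 0 ≤ K ∧ ∀ x, 0 ≤ x →
      |c * F x - A * G x| ≤ ε * G x + K * (1 - Real.exp (-x ^ 2)) := by
  have h1 : Tendsto (fun x => |c * (F x / x ^ β) - A * (G x / x ^ β)| - ε * (G x / x ^ β))
      (𝓝[>] 0) (𝓝 (|c * A - A * c| - ε * c)) :=
    (((hFl.const_mul c).sub (hGl.const_mul A)).abs).sub (hGl.const_mul ε)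
  have h2 : |c * A - A * c| - ε * c < 0 := by
    rw [mul_comm A, sub_self, abs_zero]; nlinarith [mul_pos hε hc]
  obtain ⟨δ, hδ, hδ2⟩ := mem_nhdsGT_iff_exists_Ioo_subset.1 (h1.eventually_lt_const h2)
  have hδ : 0 < δ := hδ
  have hM : 0 ≤ M := (abs_nonneg _).trans (hF 0 le_rfl)
  have hN : 0 ≤ N := (abs_nonneg _).trans (hG 0 le_rfl)
  have he : 0 < 1 - Real.exp (-δ ^ 2) := by
    have : Real.exp (-δ ^ 2) < 1 := by rw [Real.exp_lt_one_iff]; nlinarith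
    linarith
  refine ⟨(c * M + |A| * N) / (1 - Real.exp (-δ ^ 2)), by positivity, fun x hx => ?_⟩
  have hx2 := (one_sub_exp_neg_mem (sq_nonneg x)).1
  rcases hx.eq_or_lt with rfl | hx0
  · simp [hF0, hG0]
  rcases lt_or_ge x δ with hxδ | hxδ
  · have h3 := hδ2 ⟨hx0, hxδ⟩
    have hxβ : 0 < x ^ β := by positivity
    have e : c * (F x / x ^ β) - A * (G x / x ^ β) = (c * F x - A * G x) / x ^ β := by ring
    simp only [Set.mem_ofPred_eq] at h3
    rw [e, abs_div, abs_of_pos hxβ, ← mul_div_assoc, ← sub_div, div_neg_iff] at h3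
    have h4 : |c * F x - A * G x| ≤ ε * G x := by
      rcases h3 with h | h
      · linarith [h.2]
      · linarith [h.1]
    have : 0 ≤ (c * M + |A| * N) / (1 - Real.exp (-δ ^ 2)) * (1 - Real.exp (-x ^ 2)) := by
      positivity
    linarith
  · have h5 : |c * F x - A * G x| ≤ c * M + |A| * N := by
      refine (abs_sub _ _).trans ?_
      rw [abs_mul, abs_mul, abs_of_pos hc]
      have := hF x hx
      have := hG x hx
      gcongr
    have h6 : 1 - Real.exp (-δ ^ 2) ≤ 1 - Real.exp (-x ^ 2) := by gcongr
    have h7 : c * M + |A| * N ≤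
        (c * M + |A| * N) / (1 - Real.exp (-δ ^ 2)) * (1 - Real.exp (-x ^ 2)) := by
      rw [div_mul_eq_mul_div, le_div_iff₀ he]
      gcongr
    have := mul_nonneg hε.le (hGnn x)
    linarith

theorem tendsto_integral_of_comparison {p : ℝ → Measure E} {w : ℝ → ℝ}
    (hp : ∀ᶠ t in 𝓝[>] 0, IsProbabilityMeasure (p t)) (hw : ∀ᶠ t in 𝓝[>] 0, 0 ≤ w t)
    {F G : ℝ → ℝ} {A c M N Λ : ℝ} (hc : 0 < c) (hFm : Measurable F) (hGm : Measurable G)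
    (hF : ∀ x, 0 ≤ x → |F x| ≤ M) (hG : ∀ x, 0 ≤ x → |G x| ≤ N)
    (hcomp : ∀ ε : ℝ, 0 < ε → ∃ K : ℝ, 0 ≤ K ∧ ∀ x, 0 ≤ x →
      |c * F x - A * G x| ≤ ε * G x + K * (1 - Real.exp (-x ^ 2)))
    (hGl : Tendsto (fun t => w t * ∫ y, G ‖y‖ ∂p t) (𝓝[>] 0) (𝓝 Λ))
    (htail : Tendsto (fun t => w t * ∫ y, (1 - Real.exp (-‖y‖ ^ 2)) ∂p t) (𝓝[>] 0) (𝓝 0)) :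
    Tendsto (fun t => w t * ∫ y, F ‖y‖ ∂p t) (𝓝[>] 0) (𝓝 (A / c * Λ)) := by
  have hdiff : Tendsto (fun t => c * (w t * ∫ y, F ‖y‖ ∂p t) - A * (w t * ∫ y, G ‖y‖ ∂p t))
      (𝓝[>] 0) (𝓝 0) := by
    rw [Metric.tendsto_nhds]
    intro η hη
    obtain ⟨ε, hε, hεη⟩ : ∃ ε : ℝ, 0 < ε ∧ ε * Λ < η := by
      refine ⟨η / (2 * (|Λ| + 1)), by positivity, ?_⟩
      rw [div_mul_eq_mul_div, div_lt_iff₀ (by positivity)]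
      nlinarith [le_abs_self Λ, abs_nonneg Λ]
    obtain ⟨K, hK, hbound⟩ := hcomp ε hε
    have hlim : Tendsto (fun t => ε * (w t * ∫ y, G ‖y‖ ∂p t) +
        K * (w t * ∫ y, (1 - Real.exp (-‖y‖ ^ 2)) ∂p t)) (𝓝[>] 0) (𝓝 (ε * Λ + K * 0)) :=
      (hGl.const_mul ε).add (htail.const_mul K)
    filter_upwards [hlim.eventually_lt_const (by simpa using hεη), hp, hw] with t ht hpt hwt
    have hFi : Integrable (fun y => F ‖y‖) (p t) :=
      Integrable.of_bound (hFm.comp measurable_norm).aestronglyMeasurable M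
        (.of_forall fun y => hF _ (norm_nonneg y))
    have hGi : Integrable (fun y => G ‖y‖) (p t) :=
      Integrable.of_bound (hGm.comp measurable_norm).aestronglyMeasurable N
        (.of_forall fun y => hG _ (norm_nonneg y))
    have hTi : Integrable (fun y : E => 1 - Real.exp (-‖y‖ ^ 2)) (p t) :=
      Integrable.of_bound (by fun_prop) 1 (.of_forall fun y => by
        have := one_sub_exp_neg_mem (sq_nonneg ‖y‖)
        rw [Real.norm_of_nonneg this.1]; exact this.2.1)
    have e : c * (w t * ∫ y, F ‖y‖ ∂p t) - A * (w t * ∫ y, G ‖y‖ ∂p t) =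
        w t * ∫ y, (c * F ‖y‖ - A * G ‖y‖) ∂p t := by
      rw [integral_sub (hFi.const_mul c) (hGi.const_mul A), integral_const_mul, integral_const_mul]
      ring
    have h1 : |∫ y, (c * F ‖y‖ - A * G ‖y‖) ∂p t| ≤
        ε * (∫ y, G ‖y‖ ∂p t) + K * ∫ y, (1 - Real.exp (-‖y‖ ^ 2)) ∂p t := by
      rw [← integral_const_mul, ← integral_const_mul,
        ← integral_add (hGi.const_mul ε) (hTi.const_mul K)]
      refine abs_integral_le_integral_abs.trans ?_
      exact integral_mono ((hFi.const_mul c).sub (hGi.const_mul A)).abs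
        ((hGi.const_mul ε).add (hTi.const_mul K)) fun y => hbound _ (norm_nonneg y)
    rw [dist_zero_right, Real.norm_eq_abs, e, abs_mul, abs_of_nonneg hwt]
    refine lt_of_le_of_lt (mul_le_mul_of_nonneg_left h1 hwt) ?_
    linarith
  have h := (hdiff.add (hGl.const_mul A)).div_const c
  rw [zero_add, mul_div_right_comm] at h
  refine h.congr fun t => ?_
  rw [sub_add_cancel, mul_div_cancel_left₀ _ hc.ne']

end Asymptotics

section HeatContent

theorem continuous_levyExponent {E : Type*} [NormedAddCommGroup E] [InnerProductSpace ℝ E]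
    [MeasurableSpace E] [BorelSpace E] [SecondCountableTopology E] {lam : ℝ} {ν : Measure E}
    (hν : ∫⁻ y, ENNReal.ofReal (min 1 (‖y‖ ^ 2)) ∂ν < ⊤) :
    Continuous (levyExponent lam ν) := by
  have h : Integrable (fun y : E => min 1 (‖y‖ ^ 2)) ν :=
    ⟨by fun_prop, (hasFiniteIntegral_iff_ofReal (.of_forall fun y => by positivity)).2 hν⟩
  refine Continuous.add (by fun_prop) (continuous_iff_continuousAt.2 fun ξ₀ => ?_)
  refine continuousAt_of_dominated (bound := fun y => (2 + (‖ξ₀‖ + 1) ^ 2) * min 1 (‖y‖ ^ 2))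
    (.of_forall fun ξ => by fun_prop) ?_ (h.const_mul _)
    (.of_forall fun y => by fun_prop)
  filter_upwards [continuous_norm.continuousAt.eventually_lt_const (lt_add_one ‖ξ₀‖)] with ξ hξ
  refine .of_forall fun y => ?_
  rw [Real.norm_of_nonneg (by linarith [Real.cos_le_one ⟪ξ, y⟫])]
  refine (one_sub_cos_inner_le ξ y).trans ?_
  gcongr

variable {E : Type*} [NormedAddCommGroup E] [InnerProductSpace ℝ E] [FiniteDimensional ℝ E]
  [MeasurableSpace E] [BorelSpace E]

omit [FiniteDimensional ℝ E] in
theorem radialExponent_levyExponent [SecondCountableTopology E] {lam : ℝ} (hlam : 0 ≤ lam)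
    {ν : Measure E}
    (hν : ∫⁻ y, ENNReal.ofReal (min 1 (‖y‖ ^ 2)) ∂ν < ⊤) (e : E) :
    RadialExponent fun s : ℝ => levyExponent lam ν (s • e) where
  continuous := (continuous_levyExponent hν).comp (by fun_prop)
  even x := by simp [levyExponent]
  nonneg x := levyExponent_nonneg hlam _
  zero := by simp [levyExponent]
  sub_le x y := by
    rw [sub_smul]
    exact levyExponent_sub_le hlam hν _ _
  nat_mul_le n x := by
    rw [mul_smul]
    exact levyExponent_nat_smul_le hν n _

theorem measurable_sphere_average {f : E → ℝ} (hf : Measurable f) :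
    Measurable fun x : ℝ => ⨍ θ : sphere (0 : E) 1, f (x • (θ : E))
      ∂(volume : Measure E).toSphere := by
  simp only [average_eq, smul_eq_mul]
  refine Measurable.const_mul ?_ _
  refine (StronglyMeasurable.integral_prod_right
    (f := fun (x : ℝ) (θ : sphere (0 : E) 1) => f (x • (θ : E))) ?_).measurable
  exact (hf.comp (by fun_prop)).stronglyMeasurable

theorem abs_average_le {X : Type*} [MeasurableSpace X] {σ : Measure X} [IsFiniteMeasure σ]
    [NeZero σ] {f : X → ℝ} {C : ℝ} (hC : ∀ x, |f x| ≤ C) : |⨍ x, f x ∂σ| ≤ C := by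
  have h := norm_integral_le_of_norm_le_const (μ := (σ Set.univ)⁻¹ • σ) (f := f) (C := C)
    (.of_forall hC)
  simpa [average] using h

theorem tendsto_sphere_average_div [Nontrivial E] {f : E → ℝ} (hf : Measurable f) {β L : ℝ}
    {R : E → ℝ} (hR : ∀ θ : E, ‖θ‖ = 1 →
      Tendsto (fun t : ℝ => f (t • θ) / t ^ β) (𝓝[>] 0) (𝓝 (R θ)))
    (hL : ∀ x, |f x| ≤ L * ‖x‖ ^ β) :
    Tendsto (fun x : ℝ => (⨍ θ : sphere (0 : E) 1, f (x • (θ : E))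
      ∂(volume : Measure E).toSphere) / x ^ β) (𝓝[>] 0)
      (𝓝 (⨍ θ : sphere (0 : E) 1, R θ ∂(volume : Measure E).toSphere)) := by
  simp only [average_eq, smul_eq_mul, mul_div_assoc, ← integral_div]
  refine Tendsto.const_mul _ ?_
  refine tendsto_integral_filter_of_dominated_convergence (fun _ => L) ?_ ?_
    (integrable_const _) (.of_forall fun θ => hR θ (by simp))
  · exact .of_forall fun x =>
      ((hf.comp (by fun_prop)).div_const _).aestronglyMeasurable
  · filter_upwards [eventually_mem_nhdsWithin] with x hx
    have hx : 0 < x := hx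
    refine .of_forall fun θ => ?_
    have h := hL (x • (θ : E))
    rw [norm_smul, Real.norm_of_nonneg hx.le, norm_eq_of_mem_sphere, mul_one] at h
    rw [norm_div, Real.norm_eq_abs, Real.norm_of_nonneg (by positivity : 0 ≤ x ^ β),
      div_le_iff₀ (by positivity)]
    exact h

/-- The tails of the marginal laws are negligible at the scale of the generalized inverse. -/
theorem tendsto_scaled_tail [Nontrivial E] {p : ℝ → Measure E} {ψ : E → ℝ} {q b : ℝ → ℝ}
    (hp : ∀ t, 0 ≤ t → IsProbabilityMeasure (p t))
    (hchar : ∀ t, 0 ≤ t → ∀ ξ, charFun (p t) ξ = (Real.exp (-(t * ψ ξ)) : ℂ))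
    (hψc : Continuous ψ) (hψ0 : ∀ ξ, 0 ≤ ψ ξ) {D : ℝ} (hψD : ∀ ξ, ψ ξ ≤ D * (2 + ‖ξ‖ ^ 2))
    {β γ c B : ℝ} (hβγ : β < γ) (hc : 0 < c)
    (hq : ∀ s, B ≤ s → c * s ^ γ ≤ q s)
    (hb : Tendsto b (𝓝[>] 0) atTop) (hqb : ∀ᶠ t in 𝓝[>] 0, q (b t) = 1 / t) :
    Tendsto (fun t => b t ^ β * ∫ y, (1 - Real.exp (-‖y‖ ^ 2)) ∂p t) (𝓝[>] 0) (𝓝 0) := by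
  have hI : Integrable (fun z : E => D * (2 + ‖z‖ ^ 2)) (heatMeasure E) := by
    have h2 := integrable_norm_rpow_heatMeasure (E := E) (s := 2) (by norm_num)
    simp only [Real.rpow_two] at h2
    exact ((integrable_const _).add h2).const_mul _
  set M := ∫ z : E, D * (2 + ‖z‖ ^ 2) ∂heatMeasure E
  have hM : 0 ≤ M := integral_nonneg fun z => (hψ0 z).trans (hψD z)
  have hle : ∀ t, 0 ≤ t → ∫ y, (1 - Real.exp (-‖y‖ ^ 2)) ∂p t ≤ t * M := fun t ht => by
    have := hp t ht
    have h := integral_exp_neg_sq_eq (p t) (φ := fun ξ => Real.exp (-(t * ψ ξ)))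
      (hchar t ht) 1
    simp only [one_mul, one_smul] at h
    have hm := fun z => one_sub_exp_neg_mem (mul_nonneg ht (hψ0 z))
    have hi : Integrable (fun z => Real.exp (-(t * ψ z))) (heatMeasure E) :=
      Integrable.of_bound (by fun_prop) 1 (.of_forall fun z => by
        rw [Real.norm_of_nonneg (Real.exp_pos _).le]; linarith [(hm z).1])
    have hj : Integrable (fun y : E => Real.exp (-‖y‖ ^ 2)) (p t) :=
      Integrable.of_bound (by fun_prop) 1 (.of_forall fun y => by
        rw [Real.norm_of_nonneg (Real.exp_pos _).le]
        linarith [(one_sub_exp_neg_mem (sq_nonneg ‖y‖)).1])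
    have e : ∫ y, (1 - Real.exp (-‖y‖ ^ 2)) ∂p t =
        ∫ z, (1 - Real.exp (-(t * ψ z))) ∂heatMeasure E := by
      rw [integral_sub (integrable_const _) hj, integral_sub (integrable_const _) hi, h]
      simp
    rw [e, ← integral_const_mul]
    refine integral_mono ((integrable_const _).sub hi) (hI.const_mul t) fun z => ?_
    exact (hm z).2.2.trans (mul_le_mul_of_nonneg_left (hψD z) ht)
  have hlim : Tendsto (fun t => M / c * b t ^ (-(γ - β))) (𝓝[>] 0) (𝓝 (M / c * 0)) :=
    ((tendsto_rpow_neg_atTop (sub_pos.2 hβγ)).comp hb).const_mul _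
  rw [mul_zero] at hlim
  have htpos : ∀ᶠ t : ℝ in 𝓝[>] 0, 0 < t := eventually_mem_nhdsWithin
  refine squeeze_zero' ?_ ?_ hlim
  · filter_upwards [hb.eventually_gt_atTop 0] with t hbt
    exact mul_nonneg (by positivity) (integral_nonneg fun y =>
      (one_sub_exp_neg_mem (sq_nonneg ‖y‖)).1)
  · filter_upwards [hb.eventually_gt_atTop 0, hb.eventually_ge_atTop B, hqb, htpos]
      with t hbt hbB hqt ht
    have h1 : c * b t ^ γ ≤ 1 / t := hqt ▸ hq _ hbB
    have h2 : t ≤ (c * b t ^ γ)⁻¹ := by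
      rw [le_inv_comm₀ ht (by positivity)]
      simpa using h1
    calc _ ≤ b t ^ β * ((c * b t ^ γ)⁻¹ * M) := by
          refine mul_le_mul_of_nonneg_left ((hle t ht.le).trans ?_) (by positivity)
          gcongr
      _ = _ := by
          rw [neg_sub, Real.rpow_sub hbt]
          field_simp

theorem tendsto_atTop_of_eq_one_div {q b : ℝ → ℝ} (hqc : Continuous q)
    (hb0 : ∀ᶠ t in 𝓝[>] 0, 0 < b t) (hqb : ∀ᶠ t in 𝓝[>] 0, q (b t) = 1 / t) :
    Tendsto b (𝓝[>] 0) atTop := by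
  refine tendsto_atTop.2 fun M => ?_
  obtain ⟨K, hK⟩ := (isCompact_Icc (a := 0) (b := M)).bddAbove_image hqc.continuousOn
  have hinv : Tendsto (fun t : ℝ => 1 / t) (𝓝[>] 0) atTop := by
    simpa using tendsto_inv_nhdsGT_zero (𝕜 := ℝ)
  filter_upwards [hb0, hqb, hinv.eventually_gt_atTop K] with t h0 hqt ht
  by_contra! hlt
  have := hK ⟨b t, ⟨h0.le, hlt.le⟩, rfl⟩
  linarith

theorem integral_sub_eq_half_integral_average [Nontrivial E] (p : Measure E)
    [IsProbabilityMeasure p] (hp : ∀ u v : E, ‖u‖ = ‖v‖ → charFun p u = charFun p v)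
    {r : E → ℝ} (hr : Measurable r) {C : ℝ} (hC : ∀ x, |r x| ≤ C) :
    (∫ y, r y ∂p) - r 0 = 1 / 2 * ∫ y, (⨍ θ : sphere (0 : E) 1,
      (r (‖y‖ • (θ : E)) + r (-(‖y‖ • (θ : E))) - 2 * r 0)
        ∂(volume : Measure E).toSphere) ∂p := by
  have hb : ∀ x, |r x + r (-x) - 2 * r 0| ≤ 4 * C := fun x => by
    have h1 := abs_le.1 (hC x)
    have h2 := abs_le.1 (hC (-x))
    have h3 := abs_le.1 (hC 0)
    exact abs_le.2 ⟨by linarith [h1.1, h2.1, h3.2], by linarith [h1.2, h2.2, h3.1]⟩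
  have hi : Integrable r p := Integrable.of_bound hr.aestronglyMeasurable C (.of_forall hC)
  have hi' : Integrable (fun y => r (-y)) p :=
    Integrable.of_bound (hr.comp measurable_neg).aestronglyMeasurable C (.of_forall fun _ => hC _)
  rw [← integral_eq_integral_sphere_average p hp
    (f := fun x => r x + r (-x) - 2 * r 0) (by fun_prop) hb]
  have h := integral_sub (hi.add hi') (integrable_const (2 * r 0))
  simp only [Pi.add_apply] at h
  rw [h, integral_add hi hi', integral_neg_eq_of_charFun_radial p hp r]
  simp
  ring

end HeatContent
/-- Corollary 1 of the paper: for an isotropic Lévy process with radial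
characteristic exponent ψ regularly varying of index α ∈ (β, 2],
[ψ⁻(1/t)]^β (H_g^μ(t) − H_g^μ(0)) →
π^{−d/2} 4^{β/2−1} Γ((d+β)/2) (Γ(1−β/α)/Γ(1−β/2)) ∫_{S^{d−1}} R_β dσ. -/
theorem heat_content_isotropic_regular_variation
    (d : ℕ) (hd : 1 ≤ d) (β : ℝ) (hβ1 : 1 ≤ β) (hβ2 : β < 2)
    -- isotropic Lévy process: triplet (λI, 0, ν), ν rotationally invariant
    (lam : ℝ) (hlam : 0 ≤ lam)
    (ν : Measure (EuclideanSpace ℝ (Fin d)))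
    (hν0 : ν {0} = 0)
    (hνlevy : ∫⁻ y, ENNReal.ofReal (min 1 (‖y‖ ^ 2)) ∂ν < ⊤)
    (hνrot : ∀ R : EuclideanSpace ℝ (Fin d) ≃ₗᵢ[ℝ] EuclideanSpace ℝ (Fin d),
      ν.map R = ν)
    -- the characteristic exponent ψ and its radial profile ψ₀
    (ψ : EuclideanSpace ℝ (Fin d) → ℝ)
    (hψ : ∀ ξ, ψ ξ = lam * ‖ξ‖ ^ 2 + ∫ y, (1 - Real.cos ⟪ξ, y⟫) ∂ν)
    (ψ₀ : ℝ → ℝ) (hrad : ∀ ξ : EuclideanSpace ℝ (Fin d), ψ ξ = ψ₀ ‖ξ‖)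
    -- (p t) are the marginal laws of the process
    (p : ℝ → Measure (EuclideanSpace ℝ (Fin d)))
    (hp : ∀ t, 0 ≤ t → IsProbabilityMeasure (p t))
    (hchar : ∀ t, 0 ≤ t → ∀ ξ,
      ∫ x, Complex.exp (Complex.I * (⟪ξ, x⟫ : ℂ)) ∂(p t)
        = Complex.exp (-(t * ψ ξ : ℝ)))
    -- ψ₀ is regularly varying of index α ∈ (β, 2]
    (α : ℝ) (hαβ : β < α) (hα2 : α ≤ 2)
    (hψ₀meas : Measurable ψ₀) (hψ₀pos : ∀ s : ℝ, 0 < s → 0 < ψ₀ s)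
    (hψ₀reg : ∀ l : ℝ, 0 < l →
      Tendsto (fun s => ψ₀ (l * s) / ψ₀ s) atTop (𝓝 (l ^ α)))
    -- ψ*(u) = sup_{s ≤ u} ψ(s) and the generalized inverse ψ⁻ of ψ*
    (ψs : ℝ → ℝ) (hψs : ∀ u, ψs u = sSup (ψ₀ '' Set.Icc 0 u))
    (ψinv : ℝ → ℝ) (hψinv : ∀ u, ψinv u = sInf {x : ℝ | 0 ≤ x ∧ u ≤ ψs x})
    -- g bounded Borel, μ a finite Borel measure, r = g ∗ μ̌
    (g : EuclideanSpace ℝ (Fin d) → ℝ) (hgm : Measurable g)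
    (Cg : ℝ) (hgbd : ∀ x, |g x| ≤ Cg)
    (μ : Measure (EuclideanSpace ℝ (Fin d))) (hμ : IsFiniteMeasure μ)
    (r : EuclideanSpace ℝ (Fin d) → ℝ)
    (hr : ∀ x, r x = ∫ y, g (x + y) ∂μ)
    -- directional second-difference limits R_β on the sphere
    (Rβ : EuclideanSpace ℝ (Fin d) → ℝ)
    (hRβ : ∀ θ : EuclideanSpace ℝ (Fin d), ‖θ‖ = 1 →
      Tendsto (fun t : ℝ => (r (t • θ) + r (-(t • θ)) - 2 * r 0) / t ^ β)
        (𝓝[>] 0) (𝓝 (Rβ θ)))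
    (L : ℝ) (hL : 0 < L)
    (hrH : ∀ x : EuclideanSpace ℝ (Fin d),
      |r x + r (-x) - 2 * r 0| ≤ L * ‖x‖ ^ β) :
    Tendsto (fun t : ℝ => (ψinv (1 / t)) ^ β * ((∫ y, r y ∂(p t)) - r 0))
      (𝓝[>] 0)
      (𝓝 (Real.pi ^ (-(d : ℝ) / 2) * (4 : ℝ) ^ (β / 2 - 1) *
        Real.Gamma ((d + β) / 2) *
        (Real.Gamma (1 - β / α) / Real.Gamma (1 - β / 2)) *
        ∫ θ : sphere (0 : EuclideanSpace ℝ (Fin d)) 1, Rβ (θ : EuclideanSpace ℝ (Fin d))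
          ∂((volume : Measure (EuclideanSpace ℝ (Fin d))).toSphere))) := by
  have hfr : Module.finrank ℝ (EuclideanSpace ℝ (Fin d)) = d := by simp
  have : Nontrivial (EuclideanSpace ℝ (Fin d)) :=
    Module.nontrivial_of_finrank_pos (R := ℝ) (by omega)
  obtain ⟨e, he⟩ := exists_norm_eq (EuclideanSpace ℝ (Fin d)) zero_le_one
  have hβ : 0 < β := by linarith
  have hα : 0 < α := hβ.trans hαβ
  obtain rfl : ψ = levyExponent lam ν := funext hψ
  set q : ℝ → ℝ := fun s => levyExponent lam ν (s • e) with hqdef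
  have hqψ : ∀ s, 0 ≤ s → q s = ψ₀ s := fun s hs => by
    simp only [hqdef, hrad, norm_smul, he, mul_one, Real.norm_of_nonneg hs]
  have hψq : ∀ ξ, levyExponent lam ν ξ = q ‖ξ‖ := fun ξ => by
    rw [hqψ _ (norm_nonneg ξ), hrad]
  have hq : RadialExponent q := radialExponent_levyExponent hlam hνlevy e
  have hqpos : ∀ s, 0 < s → 0 < q s := fun s hs => by
    rw [hqψ s hs.le]; exact hψ₀pos s hs
  have hqreg : ∀ l, 0 < l → Tendsto (fun s => q (l * s) / q s) atTop (𝓝 (l ^ α)) := by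
    intro l hl
    refine (hψ₀reg l hl).congr' ?_
    filter_upwards [eventually_ge_atTop 0] with s hs
    rw [hqψ s hs, hqψ (l * s) (by positivity)]
  obtain ⟨γ, hβγ, hγα⟩ := exists_between hαβ
  obtain ⟨C, B, hC, hB, hpotter⟩ := hq.exists_potter hqpos hqreg (hβ.trans hβγ) hγα
  obtain ⟨c, hc, hcq⟩ := exists_mul_rpow_le_of_potter hC hB hqpos hpotter
  obtain ⟨D, hD, hψD⟩ := exists_levyExponent_le hlam hνlevy
  have htpos : ∀ᶠ t : ℝ in 𝓝[>] 0, 0 < t := eventually_mem_nhdsWithin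
  set b : ℝ → ℝ := fun t => ψinv (1 / t) with hbdef
  have hqtop : Tendsto q atTop atTop :=
    tendsto_atTop_mono' _ ((eventually_ge_atTop B).mono fun s hs => hcq s hs)
      ((tendsto_rpow_atTop (hβ.trans hβγ)).const_mul_atTop hc)
  have hspec : ∀ t, 0 < t → 0 < b t ∧ q (b t) = 1 / t := fun t ht => by
    obtain ⟨s, hs, hs'⟩ := ((eventually_ge_atTop 0).and
      (hqtop.eventually_ge_atTop (1 / t))).exists
    obtain ⟨h1, h2, -⟩ := generalizedInverse_spec
      (hq.continuous.continuousOn.congr fun x hx => (hqψ x hx).symm)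
      (by rw [← hqψ 0 le_rfl, hq.zero]) hψs hψinv (one_div_pos.2 ht) ⟨s, hs, hqψ s hs ▸ hs'⟩
    exact ⟨h1, by rw [hqψ _ h1.le]; exact h2⟩
  have hqb : ∀ᶠ t in 𝓝[>] 0, q (b t) = 1 / t := htpos.mono fun t ht => (hspec t ht).2
  have hb : Tendsto b (𝓝[>] 0) atTop :=
    tendsto_atTop_of_eq_one_div hq.continuous (htpos.mono fun t ht => (hspec t ht).1) hqb
  have hcf : ∀ t, 0 ≤ t → ∀ ξ, charFun (p t) ξ = (Real.exp (-(t * levyExponent lam ν ξ)) : ℂ) := by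
    intro t ht ξ
    rw [charFun_apply, Complex.ofReal_exp, Complex.ofReal_neg, ← hchar t ht ξ]
    simp only [mul_comm Complex.I, real_inner_comm]
  have hcfr : ∀ t, 0 ≤ t → ∀ u v, ‖u‖ = ‖v‖ → charFun (p t) u = charFun (p t) v := by
    intro t ht u v huv
    rw [hcf t ht, hcf t ht, hrad, hrad, huv]
  have hrm : Measurable r := by
    rw [funext hr]
    exact (StronglyMeasurable.integral_prod_right
      (f := fun x y => g (x + y)) (hgm.comp (by fun_prop)).stronglyMeasurable).measurable
  have hrb : ∀ x, |r x| ≤ Cg * μ.real Set.univ := fun x => by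
    rw [hr x, ← Real.norm_eq_abs]
    exact norm_integral_le_of_norm_le_const (.of_forall fun y => hgbd _)
  set f : EuclideanSpace ℝ (Fin d) → ℝ := fun x => r x + r (-x) - 2 * r 0 with hfdef
  have hfm : Measurable f := by fun_prop
  have hfb : ∀ x, |f x| ≤ 4 * (Cg * μ.real Set.univ) := fun x => by
    have h1 := abs_le.1 (hrb x)
    have h2 := abs_le.1 (hrb (-x))
    have h3 := abs_le.1 (hrb 0)
    exact abs_le.2 ⟨by linarith [h1.1, h2.1, h3.2], by linarith [h1.2, h2.2, h3.1]⟩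
  set σ := (volume : Measure (EuclideanSpace ℝ (Fin d))).toSphere with hσ
  have : NeZero σ := ⟨Measure.toSphere_ne_zero _⟩
  set F : ℝ → ℝ := fun x => ⨍ θ : sphere (0 : EuclideanSpace ℝ (Fin d)) 1, f (x • (θ : _)) ∂σ
    with hFdef
  have hF0 : F 0 = 0 := by
    have : f 0 = 0 := by simp only [hfdef, neg_zero]; ring
    simp [hFdef, this]
  have hΓ : 0 < Real.Gamma (1 - β / 2) := Real.Gamma_pos_of_pos (by linarith)
  have hG := fun x hx => (abs_of_nonneg (truncatedPower_nonneg hB x)).trans_le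
    (truncatedPower_le hβ hβ2 hB hx)
  have hGl : Tendsto (fun t => b t ^ β * ∫ y, truncatedPower β B ‖y‖ ∂p t) (𝓝[>] 0)
      (𝓝 ((∫ z : EuclideanSpace ℝ (Fin d), ‖z‖ ^ β ∂heatMeasure _) *
        (Real.Gamma (1 - β / α) / β))) := by
    refine (tendsto_scaled_integral hq hqreg hβ hβγ hαβ hC hB hpotter hb hqb).congr' ?_
    filter_upwards [htpos] with t ht
    have := hp t ht.le
    rw [integral_truncatedPower_eq hβ hB (p t) (hcf t ht.le)]
    · simp only [hψq, norm_smul, Real.norm_eq_abs]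
      congr 1
      refine setIntegral_congr_fun measurableSet_Ioi fun s hs => ?_
      simp only [abs_of_pos (hB.trans hs)]
    · intro s
      have hcont := continuous_levyExponent (lam := lam) hνlevy
      refine Integrable.of_bound (Continuous.aestronglyMeasurable (by fun_prop)) 1
        (.of_forall fun z => ?_)
      rw [Real.norm_of_nonneg (Real.exp_pos _).le, Real.exp_le_one_iff]
      have := mul_nonneg ht.le (levyExponent_nonneg (ν := ν) hlam (s • z))
      linarith
  have htail := tendsto_scaled_tail hp hcf (continuous_levyExponent hνlevy)
    (levyExponent_nonneg hlam) hψD hβγ hc hcq hb hqb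
  have hmain := tendsto_integral_of_comparison (p := p) (w := fun t => b t ^ β)
    (F := F) (htpos.mono fun t ht => hp t ht.le)
    (htpos.mono fun t ht => Real.rpow_nonneg (hspec t ht).1.le β) (div_pos hΓ hβ)
    (measurable_sphere_average hfm) measurable_truncatedPower
    (fun x _ => abs_average_le fun θ => hfb _) hG
    (fun ε hε => abs_sub_le_of_tendsto_div (div_pos hΓ hβ) hF0 truncatedPower_zero
      (fun x _ => abs_average_le fun θ => hfb _) hG
      (tendsto_sphere_average_div hfm hRβ hrH) (tendsto_truncatedPower_div hβ hβ2 hB) hε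
      (truncatedPower_nonneg hB)) hGl htail
  have hlim := hmain.const_mul (1 / 2)
  rw [integral_norm_rpow_heatMeasure hβ.le, hfr, average_eq, smul_eq_mul] at hlim
  have hσ0 : σ.real Set.univ ≠ 0 := by
    simp [Measure.real, ENNReal.toReal_eq_zero_iff, NeZero.ne]
  have h4 : (4 : ℝ) ^ (β / 2 - 1) = 4 ^ (β / 2) / 4 := by
    rw [Real.rpow_sub (by norm_num), Real.rpow_one]
  rw [← hσ] at hlim
  convert hlim.congr' ?_ using 2
  · rw [h4]
    field_simp
    ring
  · filter_upwards [htpos] with t ht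
    have := hp t ht.le
    rw [integral_sub_eq_half_integral_average (p t) (hcfr t ht.le) hrm hrb]
    ring
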